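/- arXiv:1612.05997 — 3 statements merged into one kernel-verified Lean document; each statement's English description precedes it below -/
import Mathlib

section
/- Let k ≥ 2 and let t = 2^{2k} − 2^k + 1 be the Kasami–Welch number. Then every irreducible factor P of φ_t(x,y) in the polynomial ring over an algebraic closure of F_2 satisfies P(1,1) = 0; that is, every absolutely irreducible component of the affine curve φ_t(x,y) = 0 passes through the point p = (1,1). -/
open MvPolynomial

lemma core {Ω : Type*} [Field Ω] [CharP Ω 2] [IsAlgClosed Ω] (σ : Ω →+* Ω) (y1 y2 y4 : Ω)
    (h1 : y1 * σ y1 + y2 * σ y2 + 1 + y4 * σ y4 = 0)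
    (h3 : y1 * σ (σ (σ y1)) + y2 * σ (σ (σ y2)) + 1 + y4 * σ (σ (σ y4)) = 0) :
    (σ (σ y1) = y1 ∧ σ (σ y2) = y2) ∨ y1 * σ y1 = 1 ∨
    ∃ a b, σ (σ a) = a ∧ σ (σ b) = b ∧ y2 = a * y1 + b ∧
      ∃ s, s * σ s = 1 ∧ (a * s + b) * σ (a * s + b) = 1 := by
  have two : (2 : Ω) = 0 := CharTwo.two_eq_zero
  obtain ⟨d1, hd1⟩ : ∃ d, d = σ (σ y1) - y1 := ⟨_, rfl⟩
  obtain ⟨d2, hd2⟩ : ∃ d, d = σ (σ y2) - y2 := ⟨_, rfl⟩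
  obtain ⟨d4, hd4⟩ : ∃ d, d = σ (σ y4) - y4 := ⟨_, rfl⟩
  have s1 : σ d1 = σ (σ (σ y1)) - σ y1 := by rw [hd1, map_sub]
  have s2 : σ d2 = σ (σ (σ y2)) - σ y2 := by rw [hd2, map_sub]
  have s4 : σ d4 = σ (σ (σ y4)) - σ y4 := by rw [hd4, map_sub]
  have f1 := congrArg σ h1
  have ff1 := congrArg σ f1
  have f3 := congrArg σ h3
  simp only [map_add, map_mul, map_one, map_zero] at f1 ff1 f3
  -- pairings
  have dFd : d1 * σ d1 + d2 * σ d2 + d4 * σ d4 = 0 := by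
    rw [s1, s2, s4, hd1, hd2, hd4]; linear_combination ff1 - f1 - h3 + h1
  have dFv : d1 * σ y1 + d2 * σ y2 + d4 * σ y4 = 0 := by
    rw [hd1, hd2, hd4]; linear_combination f1 - h1
  have vFd : y1 * σ d1 + y2 * σ d2 + y4 * σ d4 = 0 := by
    rw [s1, s2, s4]; linear_combination h3 - h1
  by_cases z1 : d1 = 0
  · by_cases z2 : d2 = 0
    · left
      exact ⟨by rw [z1] at hd1; linear_combination -hd1, by rw [z2] at hd2; linear_combination -hd2⟩
    · right; left
      have n2 : σ d2 ≠ 0 := by simpa using z2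
      rw [z1, map_zero] at dFd vFd
      rw [z1] at dFv
      have : y2 * σ y2 + y4 * σ y4 = 0 := by
        apply mul_left_cancel₀ (mul_ne_zero z2 n2)
        linear_combination (y2 * σ d2) * dFv - (d4 * σ y4) * vFd + (y4 * σ y4) * dFd
      linear_combination h1 - this - two
  right; right
  have n1 : σ d1 ≠ 0 := by simpa using z1
  -- the vector e = F^2 d
  obtain ⟨e1, he1⟩ : ∃ e, e = σ (σ d1) := ⟨_, rfl⟩
  obtain ⟨e2, he2⟩ : ∃ e, e = σ (σ d2) := ⟨_, rfl⟩
  obtain ⟨e4, he4⟩ : ∃ e, e = σ (σ d4) := ⟨_, rfl⟩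
  have eFd : e1 * σ d1 + e2 * σ d2 + e4 * σ d4 = 0 := by
    have := congrArg σ dFd
    simp only [map_add, map_mul, map_zero] at this
    rw [he1, he2, he4]; linear_combination this
  have eFv : e1 * σ y1 + e2 * σ y2 + e4 * σ y4 = 0 := by
    have := congrArg σ vFd
    simp only [map_add, map_mul, map_zero] at this
    rw [he1, he2, he4]; linear_combination this
  obtain ⟨m1, hm1⟩ : ∃ m, m = e2 * d4 - e4 * d2 := ⟨_, rfl⟩
  obtain ⟨m2, hm2⟩ : ∃ m, m = e4 * d1 - e1 * d4 := ⟨_, rfl⟩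
  obtain ⟨m4, hm4⟩ : ∃ m, m = e1 * d2 - e2 * d1 := ⟨_, rfl⟩
  -- n × p = 0, n × r = 0
  have np1 : m2 * σ y4 - m4 * σ y2 = 0 := by
    rw [hm2, hm4]; linear_combination d1 * eFv - e1 * dFv
  have np2 : m4 * σ y1 - m1 * σ y4 = 0 := by
    rw [hm1, hm4]; linear_combination d2 * eFv - e2 * dFv
  have np4 : m1 * σ y2 - m2 * σ y1 = 0 := by
    rw [hm1, hm2]; linear_combination d4 * eFv - e4 * dFv
  have nr2 : m4 * σ d1 - m1 * σ d4 = 0 := by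
    rw [hm1, hm4]; linear_combination d2 * eFd - e2 * dFd
  have nr4 : m1 * σ d2 - m2 * σ d1 = 0 := by
    rw [hm1, hm2]; linear_combination d4 * eFd - e4 * dFd
  have key : y1 * m1 + y2 * m2 + y4 * m4 = 0 := by
    apply mul_left_cancel₀ n1
    linear_combination m1 * vFd - y2 * nr4 + y4 * nr2
  have q2 : m2 = 0 := by
    linear_combination (-σ y2) * key + m2 * h1 - y4 * np1 + y1 * np4
  have q4 : m4 = 0 := by
    linear_combination (-σ y4) * key + m4 * h1 - y1 * np2 + y2 * np1
  obtain ⟨a, ha⟩ : ∃ a, a = d2 / d1 := ⟨_, rfl⟩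
  obtain ⟨a', ha'⟩ : ∃ a, a = d4 / d1 := ⟨_, rfl⟩
  have e1n : e1 ≠ 0 := by rw [he1]; simpa using z1
  have ad : d2 = a * d1 := by rw [ha]; field_simp
  have ad' : d4 = a' * d1 := by rw [ha']; field_simp
  have fa : σ (σ a) = a := by
    rw [ha, map_div₀, map_div₀, ← he1, ← he2, div_eq_div_iff e1n z1]
    linear_combination hm4 - q4
  have fa' : σ (σ a') = a' := by
    rw [ha', map_div₀, map_div₀, ← he1, ← he4, div_eq_div_iff e1n z1]
    linear_combination q2 - hm2
  obtain ⟨b, hb⟩ : ∃ b, b = y2 - a * y1 := ⟨_, rfl⟩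
  obtain ⟨b', hb'⟩ : ∃ b, b = y4 - a' * y1 := ⟨_, rfl⟩
  have fb : σ (σ b) = b := by
    rw [hb]; simp only [map_sub, map_mul, fa]
    linear_combination ad - hd2 + a * hd1
  have aFa : 1 + a * σ a + a' * σ a' = 0 := by
    apply mul_left_cancel₀ (mul_ne_zero z1 n1)
    rw [ad, ad'] at dFd
    simp only [map_mul] at dFd
    linear_combination dFd
  have aFv : σ y1 + a * σ y2 + a' * σ y4 = 0 := by
    apply mul_left_cancel₀ z1
    linear_combination dFv - σ y2 * ad - σ y4 * ad'
  have vFa : y1 + y2 * σ a + y4 * σ a' = 0 := by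
    apply mul_left_cancel₀ n1
    rw [ad, ad'] at vFd
    simp only [map_mul] at vFd
    linear_combination vFd
  have aFb : a * σ b + a' * σ b' = 0 := by
    rw [hb, hb']; simp only [map_sub, map_mul]
    linear_combination aFv - σ y1 * aFa
  have bFa : b * σ a + b' * σ a' = 0 := by
    rw [hb, hb']
    linear_combination vFa - y1 * aFa
  have bFb : b * σ b + 1 + b' * σ b' = 0 := by
    have : b * σ y2 + 1 + b' * σ y4 = 0 := by
      rw [hb, hb']; linear_combination h1 - y1 * aFv
    have t1 : σ b = σ y2 - σ a * σ y1 := by rw [hb]; simp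
    have t2 : σ b' = σ y4 - σ a' * σ y1 := by rw [hb']; simp
    rw [t1, t2]
    linear_combination this - σ y1 * bFa
  have AB : a * σ a + b * σ b + 1 = 0 := by
    linear_combination (-(b * σ a)) * aFb + (a' * σ b') * bFa - (b' * σ b') * aFa +
      (1 + a * σ a) * bFb
  refine ⟨a, b, fa, fb, by rw [hb]; ring, ?_⟩
  by_cases hc : a * σ b = 0
  · refine ⟨1, by simp, ?_⟩
    have hc' : b * σ a = 0 := by
      have := congrArg σ hc
      simp only [map_mul, map_zero, fb] at this
      linear_combination this
    simp only [mul_one, map_add]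
    linear_combination AB + hc + hc' - two
  · obtain ⟨c, hcd⟩ : ∃ c, c = a * σ b := ⟨_, rfl⟩
    rw [← hcd] at hc
    have sc : σ c = b * σ a := by rw [hcd, map_mul, fb]; ring
    have ssc : σ (σ c) = c := by rw [sc, map_mul, fa, hcd]; ring
    have nc : σ c ≠ 0 := by simpa using hc
    obtain ⟨r, hr⟩ := IsAlgClosed.exists_eq_mul_self (c * σ c)
    have sr : σ r = r := by
      have h := congrArg σ hr
      rw [map_mul, map_mul, ssc] at h
      have : (σ r - r) ^ 2 = 0 := by
        linear_combination hr - h + (r * r - σ r * r) * two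
      have := pow_eq_zero_iff (two_ne_zero) |>.1 this
      linear_combination this
    have hN : r / c * σ (r / c) = 1 := by
      rw [map_div₀, sr]; field_simp; linear_combination -hr
    refine ⟨r / c, hN, ?_⟩
    have u1 : c * (r / c) = r := by field_simp
    have u2 : σ c * σ (r / c) = r := by rw [← map_mul, u1, sr]
    rw [sc] at u2
    simp only [map_add, map_mul]
    linear_combination (a * σ a) * hN + AB + u1 + u2 - (r / c) * hcd + (r - 1) * two

lemma finite_mem_range {K Ω : Type*} [Field K] [IsAlgClosed K] [Field Ω] [Algebra K Ω] (z : Ω)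
    (hz : IsAlgebraic K z) : ∃ w : K, algebraMap K Ω w = z := by
  obtain ⟨p, hp, h⟩ := hz
  have := (IsAlgClosed.splits p).mem_range_of_isRoot (i := algebraMap K Ω) (x := z) hp
  simpa using this (by simpa [Polynomial.IsRoot, Polynomial.eval_map_algebraMap] using h)

lemma lin_irreducible {K : Type*} [Field K] (i : Fin 2) (c : K) :
    Irreducible (X i - C c : MvPolynomial (Fin 2) K) := by
  have hc : coeff (Finsupp.single i 1) (X i - C c : MvPolynomial (Fin 2) K) = 1 := by
    simp [coeff_C, coeff_X]
    intro h
    exact absurd h.symm (Finsupp.single_ne_zero.2 one_ne_zero)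
  apply irreducible_of_totalDegree_eq_one
  · apply le_antisymm
    · refine (totalDegree_sub_C_le _ _).trans ?_
      simp
    · have := le_totalDegree (p := (X i - C c : MvPolynomial (Fin 2) K)) (s := Finsupp.single i 1)
        (by rw [mem_support_iff, hc]; exact one_ne_zero)
      simpa using this
  · intro x h
    have := h (Finsupp.single i 1)
    rw [hc] at this
    exact isUnit_of_dvd_one this

lemma generic_point {K : Type} [Field K] (P : MvPolynomial (Fin 2) K) (hP : Irreducible P) :
    ∃ (Ω : Type) (_ : Field Ω) (_ : Algebra K Ω) (_ : IsAlgClosed Ω) (x : Fin 2 → Ω),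
      ∀ Q, aeval x Q = 0 ↔ P ∣ Q := by
  have hp : Prime P := hP.prime
  have : (Ideal.span {P}).IsPrime := (Ideal.span_singleton_prime hp.ne_zero).2 hp
  let A := MvPolynomial (Fin 2) K ⧸ Ideal.span {P}
  let L := FractionRing A
  refine ⟨AlgebraicClosure L, inferInstance, inferInstance, inferInstance,
    fun i => algebraMap A (AlgebraicClosure L) (Ideal.Quotient.mk _ (X i)), ?_⟩
  intro Q
  let f : MvPolynomial (Fin 2) K →ₐ[K] AlgebraicClosure L :=
    (IsScalarTower.toAlgHom K A (AlgebraicClosure L)).comp (Ideal.Quotient.mkₐ K _)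
  have hf : f = aeval (fun i => algebraMap A (AlgebraicClosure L) (Ideal.Quotient.mk _ (X i))) := by
    ext i
    simp [f]
    rfl
  rw [← hf]
  have inj : Function.Injective (algebraMap A (AlgebraicClosure L)) := by
    rw [IsScalarTower.algebraMap_eq A L (AlgebraicClosure L)]
    exact (algebraMap L (AlgebraicClosure L)).injective.comp (IsFractionRing.injective A L)
  have : f Q = algebraMap A (AlgebraicClosure L) (Ideal.Quotient.mk _ Q) := rfl
  rw [this, map_eq_zero_iff _ inj, Ideal.Quotient.eq_zero_iff_mem, Ideal.mem_span_singleton]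

lemma not_const {K Ω : Type*} [Field K] [Field Ω] [Algebra K Ω]
    (P : MvPolynomial (Fin 2) K) (hP : Irreducible P) (x : Fin 2 → Ω)
    (hx : ∀ Q, aeval x Q = 0 ↔ P ∣ Q) (u v : K) (hu : algebraMap K Ω u = x 0)
    (hv : algebraMap K Ω v = x 1) : False := by
  have h0 : P ∣ X 0 - C u := by rw [← hx]; simp [hu]
  have h1 : P ∣ X 1 - C v := by rw [← hx]; simp [hv]
  have h2 := (hP.associated_of_dvd (lin_irreducible 0 u) h0).symm.dvd.trans h1
  obtain ⟨R, hR⟩ := h2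
  have := congrArg (eval ![u, v + 1]) hR
  simp at this

lemma main_aux (k t : ℕ) (hk : 2 ≤ k)
    (ht : t = 2 ^ (2 * k) - 2 ^ k + 1) {K : Type} [Field K] [IsAlgClosed K] [CharP K 2]
    (P : MvPolynomial (Fin 2) K) (hP : Irreducible P)
    (hd : P ∣ X 0 ^ t + X 1 ^ t + 1 + (X 0 + X 1 + 1) ^ t) :
    MvPolynomial.eval (fun _ => 1) P = 0 := by
  obtain ⟨Ω, _, _, _, x, hx⟩ := generic_point P hP
  have : CharP Ω 2 := charP_of_injective_algebraMap (algebraMap K Ω).injective 2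
  have two : (2 : Ω) = 0 := CharTwo.two_eq_zero
  have e := (hx _).2 hd
  simp only [map_add, map_pow, aeval_X, map_one] at e
  let σ : Ω →+* Ω := iterateFrobenius Ω 2 k
  have hσ : ∀ z, σ z = z ^ 2 ^ k := fun z => iterateFrobenius_def _ _ _
  have pos : 0 < 2 ^ k + 1 := by positivity
  obtain ⟨y1, g1⟩ := IsAlgClosed.exists_pow_nat_eq (x 0) pos
  obtain ⟨y2, g2⟩ := IsAlgClosed.exists_pow_nat_eq (x 1) pos
  obtain ⟨y4, g4⟩ := IsAlgClosed.exists_pow_nat_eq (x 0 + x 1 + 1) pos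
  have N : ∀ z, z * σ z = z ^ (2 ^ k + 1) := fun z => by rw [hσ]; ring
  have hexp : (2 ^ k + 1) * t = 2 ^ k * 2 ^ k * 2 ^ k + 1 := by
    have : t + 2 ^ k = 2 ^ k * 2 ^ k + 1 := by
      have : 2 ^ k ≤ 2 ^ (2 * k) := Nat.pow_le_pow_right (by norm_num) (by omega)
      have e2 : 2 ^ (2 * k) = 2 ^ k * 2 ^ k := by rw [two_mul, pow_add]
      omega
    zify at this ⊢
    linear_combination (2 ^ k + 1 : ℤ) * this
  have N3 : ∀ z, z * σ (σ (σ z)) = (z ^ (2 ^ k + 1)) ^ t := fun z => by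
    rw [← pow_mul, hexp, hσ, hσ, hσ]; ring
  have fin : ∀ z, σ (σ z) = z → ∃ w : K, algebraMap K Ω w = z := by
    intro z hz
    refine finite_mem_range z ⟨Polynomial.X ^ (2 ^ k * 2 ^ k) - Polynomial.X, ?_, ?_⟩
    · refine FiniteField.X_pow_card_sub_X_ne_zero K ?_
      have : 1 < 2 ^ k := Nat.one_lt_two_pow (by omega)
      nlinarith
    · rw [hσ, hσ, ← pow_mul] at hz
      simp [hz]
  have c1 : y1 * σ y1 + y2 * σ y2 + 1 + y4 * σ y4 = 0 := by
    rw [N, N, N, g1, g2, g4]; linear_combination (x 0 + x 1 + 1) * two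
  have c3 : y1 * σ (σ (σ y1)) + y2 * σ (σ (σ y2)) + 1 + y4 * σ (σ (σ y4)) = 0 := by
    rw [N3, N3, N3, g1, g2, g4]; exact e
  rcases core σ y1 y2 y4 c1 c3 with ⟨f1, f2⟩ | h | ⟨a, b, fa, fb, hy, s, hs, hs2⟩
  · obtain ⟨u, hu⟩ := fin _ f1
    obtain ⟨v, hv⟩ := fin _ f2
    exact (not_const P hP x hx (u ^ (2 ^ k + 1)) (v ^ (2 ^ k + 1)) (by rw [map_pow, hu, g1])
      (by rw [map_pow, hv, g2])).elim
  · rw [N, g1] at h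
    have h0 : P ∣ X 0 - C 1 := by rw [← hx]; simp [h]
    have h2 := (hP.associated_of_dvd (lin_irreducible 0 1) h0).symm.dvd
    obtain ⟨R, hR⟩ := h2
    rw [hR]; simp
  · obtain ⟨α, rfl⟩ := fin _ fa
    obtain ⟨β, rfl⟩ := fin _ fb
    let g : Fin 2 → Polynomial K := ![Polynomial.X ^ (2 ^ k + 1),
      (Polynomial.C α * Polynomial.X + Polynomial.C β) ^ (2 ^ k + 1)]
    have comp : ∀ z : Ω, Polynomial.aeval z (aeval g P) =
        aeval ![z ^ (2 ^ k + 1), (algebraMap K Ω α * z + algebraMap K Ω β) ^ (2 ^ k + 1)] P := by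
      intro z
      rw [← AlgHom.comp_apply, MvPolynomial.comp_aeval]
      congr 2
      funext i
      fin_cases i <;> simp [g]
    have G0 : aeval g P = 0 := by
      by_contra hne
      have hz : Polynomial.aeval y1 (aeval g P) = 0 := by
        rw [comp, ← hy, g1, g2]
        have : ![x 0, x 1] = x := by funext i; fin_cases i <;> rfl
        rw [this, hx]
      obtain ⟨w, hw⟩ := finite_mem_range (K := K) y1 ⟨_, hne, hz⟩
      refine not_const P hP x hx (w ^ (2 ^ k + 1)) ((α * w + β) ^ (2 ^ k + 1)) (by rw [map_pow, hw, g1])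
        ?_
      rw [map_pow, map_add, map_mul, hw, ← hy, g2]
    have := comp s
    rw [G0, map_zero, ← N, ← N, hs, hs2] at this
    have h1 : (![1, 1] : Fin 2 → Ω) = algebraMap K Ω ∘ (fun _ => 1) := by
      funext i; fin_cases i <;> simp
    rw [h1, MvPolynomial.aeval_algebraMap_apply] at this
    have := (map_eq_zero_iff _ (algebraMap K Ω).injective).1 this.symm
    simpa using this

theorem kasami_components_through_one_one (k : ℕ) (hk : 2 ≤ k) (t : ℕ)
    (ht : t = 2 ^ (2 * k) - 2 ^ k + 1)
    (phi : MvPolynomial (Fin 2) (ZMod 2))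
    (hphi : phi * ((X 0 + X 1) * (X 0 + 1) * (X 1 + 1)) =
      X 0 ^ t + X 1 ^ t + 1 + (X 0 + X 1 + 1) ^ t)
    (P : MvPolynomial (Fin 2) (AlgebraicClosure (ZMod 2)))
    (hP : Irreducible P)
    (hPdvd : P ∣ MvPolynomial.map (algebraMap (ZMod 2) (AlgebraicClosure (ZMod 2))) phi) :
    MvPolynomial.eval (fun _ => 1) P = 0 := by
  have : CharP (AlgebraicClosure (ZMod 2)) 2 :=
    charP_of_injective_algebraMap (algebraMap (ZMod 2) (AlgebraicClosure (ZMod 2))).injective 2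
  refine main_aux k t hk ht P hP ?_
  have := congrArg (MvPolynomial.map (algebraMap (ZMod 2) (AlgebraicClosure (ZMod 2)))) hphi
  simp only [map_mul, map_add, map_pow, map_X, map_one] at this
  rw [← this]
  exact hPdvd.mul_right _
end

section
/- Let k ≥ 2 and let t = 2^{2k} − 2^k + 1 be the Kasami–Welch number. The absolutely irreducible components of φ_t(x,y) intersect transversally at the point p = (1,1): every irreducible factor P of φ_t(x,y) in the polynomial ring over an algebraic closure of F_2 satisfies P(1,1) = 0 and has nonzero gradient at (1,1) (so (1,1) is a simple point of each component), and for any two irreducible factors P, P' of φ_t(x,y) over the algebraic closure that are not associates, the gradient vectors of P and of P' at (1,1) are not proportional (the tangent lines at (1,1) are pairwise distinct). -/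
open MvPolynomial

namespace Kas

lemma conj_id {R : Type*} [CommRing R] [CharP R 2] (A B c r : R) (m : ℕ)
    (hA : A * c = 1) (hB : B * (c + 1) = 1) (hc : c ^ 2 ^ m = c) :
    A * r ^ (2 ^ m + 1) + B * (r + 1) ^ (2 ^ m + 1) + 1 = A * B * (r + c) ^ (2 ^ m + 1) := by
  have : Fact (Nat.Prime 2) := ⟨Nat.prime_two⟩
  have h2 : (2 : R) = 0 := CharTwo.two_eq_zero
  rw [pow_succ, pow_succ, pow_succ, add_pow_char_pow, add_pow_char_pow, hc, one_pow]
  generalize r ^ 2 ^ m = u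
  have e1 : A + B = A * B := by
    linear_combination (-B) * hA + (-A) * hB + A * B * c * h2
  have e2 : B + 1 = B * c := by linear_combination (-1) * hB + B * h2
  linear_combination (r * u) * e1 + e2 - (B * (r + u) + B * c) * hA

lemma tnum (k : ℕ) (t : ℕ) (ht : t = 2 ^ (2 * k) - 2 ^ k + 1) :
    t + 2 ^ k = 2 ^ (2 * k) + 1 ∧ (2 ^ k + 1) * t = 2 ^ (3 * k) + 1 := by
  have h1 : 2 ^ k ≤ 2 ^ (2 * k) := Nat.pow_le_pow_right (by norm_num) (by omega)
  have a : t + 2 ^ k = 2 ^ (2 * k) + 1 := by omega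
  refine ⟨a, ?_⟩
  have e2 : 2 ^ (2 * k) = 2 ^ k * 2 ^ k := by rw [two_mul, pow_add]
  have e3 : 2 ^ (3 * k) = 2 ^ k * 2 ^ k * 2 ^ k := by rw [← pow_add, ← pow_add]; congr 1; ring
  rw [e3]; rw [e2] at a
  zify at a ⊢
  linear_combination (2 ^ k + 1) * a

lemma pow_fix {K : Type*} [Monoid K] (c : K) (k n : ℕ) (hc : c ^ 2 ^ k = c) : c ^ 2 ^ (n * k) = c := by
  induction n with
  | zero => simp
  | succ n ih => rw [add_mul, one_mul, pow_add, pow_mul, ih, hc]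

lemma pow_t {K : Type*} [Field K] (c : K) (k t : ℕ) (ht : t + 2 ^ k = 2 ^ (2 * k) + 1)
    (hc : c ^ 2 ^ k = c) (h0 : c ≠ 0) : c ^ t = c := by
  have : c ^ (t + 2 ^ k) = c * c := by rw [ht, pow_succ, pow_fix c k 2 hc]
  rw [pow_add, hc] at this
  exact mul_right_cancel₀ h0 this

noncomputable def th {K : Type*} [Field K] (k : ℕ) (b : K) :
    MvPolynomial (Fin 2) K →ₐ[K] Polynomial K :=
  aeval ![Polynomial.C ((b ^ 2)⁻¹) * Polynomial.X ^ (2 ^ k + 1),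
    Polynomial.C ((b ^ 2 + 1)⁻¹) * (Polynomial.X + 1) ^ (2 ^ k + 1)]

set_option linter.unusedSectionVars false
variable {K : Type*} [Field K] [CharP K 2]

lemma bsq {b : K} (h1 : b ≠ 1) : b ^ 2 + 1 ≠ 0 := by
  have h2 : (2 : K) = 0 := CharTwo.two_eq_zero
  intro h
  have : (b - 1) ^ 2 = 0 := by linear_combination h - b * h2
  exact h1 (sub_eq_zero.mp (pow_eq_zero_iff (two_ne_zero)|>.mp this))

lemma th_f (k t : ℕ) (ht : t = 2 ^ (2 * k) - 2 ^ k + 1) (b : K) (hb : b ^ 2 ^ k = b)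
    (h0 : b ≠ 0) (h1 : b ≠ 1) :
    th k b (X 0 ^ t + X 1 ^ t + 1 + (X 0 + X 1 + 1) ^ t) = 0 := by
  have : Fact (Nat.Prime 2) := ⟨Nat.prime_two⟩
  obtain ⟨t1, t2⟩ := tnum k t ht
  have hc0 : b ^ 2 ≠ 0 := pow_ne_zero _ h0
  have hc1 := bsq h1
  have hcq : (b ^ 2) ^ 2 ^ k = b ^ 2 := by rw [← pow_mul, mul_comm, pow_mul, hb]
  have hcq1 : (b ^ 2 + 1) ^ 2 ^ k = b ^ 2 + 1 := by rw [add_pow_char_pow, hcq, one_pow]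
  simp only [th, map_add, map_pow, aeval_X, map_one, Matrix.cons_val_zero, Matrix.cons_val_one]
  generalize hc : b ^ 2 = c at *
  have hA : (Polynomial.C c⁻¹) * Polynomial.C c = 1 := by
    rw [← Polynomial.C_mul, inv_mul_cancel₀ hc0, Polynomial.C_1]
  have hB : (Polynomial.C (c + 1)⁻¹) * (Polynomial.C c + 1) = 1 := by
    rw [← Polynomial.C_1, ← Polynomial.C_add, ← Polynomial.C_mul, inv_mul_cancel₀ hc1]
  have hAt : (Polynomial.C c⁻¹) ^ t = Polynomial.C c⁻¹ := by
    rw [← Polynomial.C_pow, inv_pow, pow_t c k t t1 hcq hc0]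
  have hBt : (Polynomial.C (c + 1)⁻¹) ^ t = Polynomial.C (c + 1)⁻¹ := by
    rw [← Polynomial.C_pow, inv_pow, pow_t (c + 1) k t t1 hcq1 hc1]
  have hC : ∀ n, (Polynomial.C c) ^ 2 ^ (n * k) = Polynomial.C c := fun n => by
    rw [← Polynomial.C_pow, pow_fix c k n hcq]
  have i1 := conj_id _ _ _ (Polynomial.X) (1 * k) hA hB (hC 1)
  have i3 := conj_id _ _ _ (Polynomial.X) (3 * k) hA hB (hC 3)
  rw [one_mul] at i1
  rw [i1]
  simp only [mul_pow, hAt, hBt]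
  rw [← pow_mul, ← pow_mul, ← pow_mul, t2, i3]
  exact CharTwo.add_self_eq_zero _

lemma th_phi (k t : ℕ) (ht : t = 2 ^ (2 * k) - 2 ^ k + 1) (b : K) (hb : b ^ 2 ^ k = b)
    (h0 : b ≠ 0) (h1 : b ≠ 1) (phi : MvPolynomial (Fin 2) K)
    (hphi : phi * ((X 0 + X 1) * (X 0 + 1) * (X 1 + 1)) =
      X 0 ^ t + X 1 ^ t + 1 + (X 0 + X 1 + 1) ^ t) : th k b phi = 0 := by
  have h2 : (2 : K) = 0 := CharTwo.two_eq_zero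
  have h := th_f k t ht b hb h0 h1
  rw [← hphi, map_mul] at h
  refine (mul_eq_zero.mp h).resolve_right ?_
  intro h
  have := congrArg (Polynomial.eval 0) h
  have hc1 := bsq h1
  simp [th, hc1] at this
  apply h0
  have h3 : (b ^ 2 + 1)⁻¹ * (b ^ 2 + 1) = 1 := inv_mul_cancel₀ hc1
  have : b ^ 2 = 0 := by linear_combination (b ^ 2 + 1) * this - h3 - h2
  exact pow_eq_zero_iff (two_ne_zero) |>.mp this

lemma eval_th (k : ℕ) (b r : K) (p : MvPolynomial (Fin 2) K) :
    Polynomial.eval r (th k b p) =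
      eval (Fin.cons ((b ^ 2)⁻¹ * r ^ (2 ^ k + 1))
        (fun _ : Fin 1 => (b ^ 2 + 1)⁻¹ * (r + 1) ^ (2 ^ k + 1))) p := by
  induction p using MvPolynomial.induction_on with
  | C a => simp [th]
  | add p q hp hq => simp [hp, hq]
  | mul_X p i hp =>
    rw [map_mul, Polynomial.eval_mul, hp, map_mul]
    fin_cases i <;> simp [th]

lemma chain (g : Fin 2 → Polynomial K) (p : MvPolynomial (Fin 2) K) :
    Polynomial.derivative (aeval g p) =
      aeval g (pderiv 0 p) * Polynomial.derivative (g 0) +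
      aeval g (pderiv 1 p) * Polynomial.derivative (g 1) := by
  induction p using MvPolynomial.induction_on with
  | C a => simp
  | add p q hp hq => simp [hp, hq]; ring
  | mul_X p i hp =>
    rw [map_mul, Polynomial.derivative_mul, hp]
    fin_cases i <;> simp [pderiv_X] <;> ring

/-- quotient (r^n+s^n)/(r+s) in terms of symmetric functions -/
def E {R : Type*} [CommRing R] (e1 e2 : R) : ℕ → R
  | 0 => 0
  | 1 => 1
  | (n + 2) => e1 * E e1 e2 (n + 1) + e2 * E e1 e2 n

lemma E_spec {R : Type*} [CommRing R] [CharP R 2] (r s : R) (n : ℕ) :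
    (r + s) * E (r + s) (r * s) n = r ^ n + s ^ n ∧
    (r + s) * E (r + s) (r * s) (n + 1) = r ^ (n + 1) + s ^ (n + 1) := by
  have h2 : (2 : R) = 0 := CharTwo.two_eq_zero
  induction n with
  | zero => constructor
            · simp [E]; linear_combination -h2
            · simp [E]
  | succ n ih =>
    refine ⟨ih.2, ?_⟩
    simp only [E]
    linear_combination (r + s) * ih.2 + (r * s) * ih.1 + (r ^ n + s ^ n) * r * s * h2

lemma E_map {R S : Type*} [CommRing R] [CommRing S] (f : R →+* S) (e1 e2 : R) (n : ℕ) :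
    f (E e1 e2 n) = E (f e1) (f e2) n ∧ f (E e1 e2 (n + 1)) = E (f e1) (f e2) (n + 1) := by
  induction n with
  | zero => simp [E]
  | succ n ih => exact ⟨ih.2, by simp only [E, map_add, map_mul, ih.1, ih.2]⟩

noncomputable def G (k : ℕ) (b : K) : MvPolynomial (Fin 2) K :=
  C (b ^ 2) * X 0 + (C (b ^ 2) * X 0) ^ 2 ^ k +
    (C (b ^ 2 + 1) * X 1 + C (b ^ 2) * X 0 + 1) *
      E (C (b ^ 2 + 1) * X 1 + C (b ^ 2) * X 0 + 1) (C (b ^ 2) * X 0) (2 ^ k + 1)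

lemma th_G (k : ℕ) (b : K) (h0 : b ≠ 0) (h1 : b ≠ 1) : th k b (G k b) = 0 := by
  have : Fact (Nat.Prime 2) := ⟨Nat.prime_two⟩
  have h2 : (2 : Polynomial K) = 0 := CharTwo.two_eq_zero
  have hc0 : b ^ 2 ≠ 0 := pow_ne_zero _ h0
  have hc1 := bsq h1
  have e2 : th k b (C (b ^ 2) * X 0) = Polynomial.X * Polynomial.X ^ 2 ^ k := by
    simp only [th, map_mul, aeval_X, Matrix.cons_val_zero, aeval_C, Polynomial.algebraMap_eq]
    rw [← mul_assoc, ← Polynomial.C_mul, mul_inv_cancel₀ hc0, Polynomial.C_1, one_mul, pow_succ']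
  have e3 : th k b (C (b ^ 2 + 1) * X 1) = (Polynomial.X + 1) * (Polynomial.X ^ 2 ^ k + 1) := by
    simp only [th, map_mul, aeval_X, Matrix.cons_val_one, Matrix.cons_val_fin_one, aeval_C, Polynomial.algebraMap_eq]
    rw [← mul_assoc, ← Polynomial.C_mul, mul_inv_cancel₀ hc1, Polynomial.C_1, one_mul, pow_succ',
      add_pow_char_pow, one_pow]
  have e1 : th k b (C (b ^ 2 + 1) * X 1 + C (b ^ 2) * X 0 + 1) =
      Polynomial.X + Polynomial.X ^ 2 ^ k := by
    rw [map_add, map_add, e2, e3, map_one]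
    linear_combination (1 + Polynomial.X * Polynomial.X ^ 2 ^ k) * h2
  have eE := (E_map (th k b : MvPolynomial (Fin 2) K →+* Polynomial K)
    (C (b ^ 2 + 1) * X 1 + C (b ^ 2) * X 0 + 1) (C (b ^ 2) * X 0) (2 ^ k)).2
  simp only [RingHom.coe_coe] at eE
  rw [G, map_add, map_add, map_mul (th k b) (C (b ^ 2 + 1) * X 1 + C (b ^ 2) * X 0 + 1),
    map_pow (th k b) (C (b ^ 2) * X 0),
    eE, e1, e2, (E_spec _ _ _).2, mul_pow, ← pow_succ', ← pow_succ']
  exact CharTwo.add_self_eq_zero _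

lemma grad_G (k : ℕ) (hk : 2 ≤ k) (b : K) (h0 : b ≠ 0) (h1 : b ≠ 1) :
    eval (fun _ => 1) (pderiv 0 (G k b)) ≠ 0 ∨ eval (fun _ => 1) (pderiv 1 (G k b)) ≠ 0 := by
  have h2 : (2 : K) = 0 := CharTwo.two_eq_zero
  have hc0 : b ^ 2 ≠ 0 := pow_ne_zero _ h0
  have hc1 := bsq h1
  have hz : b ^ 2 + 1 + b ^ 2 + 1 = 0 := by linear_combination (1 + b ^ 2) * h2
  have hq : (2 : K) ^ k = 0 := by rw [h2, zero_pow (by omega)]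
  by_contra! h
  obtain ⟨ha, hb⟩ := h
  rw [G] at ha hb
  generalize E (C (b ^ 2 + 1) * X 1 + C (b ^ 2) * X 0 + 1 : MvPolynomial (Fin 2) K)
    (C (b ^ 2) * X 0) (2 ^ k + 1) = e at ha hb
  simp only [map_add, Derivation.leibniz, Derivation.leibniz_pow, pderiv_X, pderiv_C, smul_eq_mul,
    map_mul, eval_C, eval_X, nsmul_eq_mul, map_one, map_natCast, Derivation.map_one_eq_zero] at ha hb
  push_cast at ha hb
  simp [hq, hz] at ha hb
  generalize hE : eval (fun _ => 1) e = v at ha hb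
  rcases hb with hb | hb
  · simp [hb, hc0] at ha
  · exact hc1 hb

/-- The Krull dimension argument. -/
lemma dvd_of_th (k : ℕ) (b : K) (h0 : b ≠ 0)
    (P H : MvPolynomial (Fin 2) K) (hP : Irreducible P) (h : th k b P = 0) (hH : th k b H = 0) :
    P ∣ H := by
  by_contra hd
  have hprime : Prime P := hP.prime
  let p0 : PrimeSpectrum (MvPolynomial (Fin 2) K) := ⟨⊥, Ideal.isPrime_bot⟩
  let p1 : PrimeSpectrum (MvPolynomial (Fin 2) K) :=
    ⟨Ideal.span {P}, (Ideal.span_singleton_prime hP.ne_zero).mpr hprime⟩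
  let p2 : PrimeSpectrum (MvPolynomial (Fin 2) K) :=
    ⟨RingHom.ker (th k b), RingHom.ker_isPrime _⟩
  let ev : MvPolynomial (Fin 2) K →+* K := (Polynomial.evalRingHom 0).comp (th k b : _ →+* _)
  let p3 : PrimeSpectrum (MvPolynomial (Fin 2) K) := ⟨RingHom.ker ev, RingHom.ker_isPrime _⟩
  have l01 : p0 < p1 := by
    change (⊥ : Ideal _) < Ideal.span {P}
    rw [bot_lt_iff_ne_bot, Ne, Ideal.span_singleton_eq_bot]
    exact hP.ne_zero
  have l12 : p1 < p2 := by
    change Ideal.span {P} < RingHom.ker (th k b)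
    refine lt_of_le_of_ne ?_ ?_
    · rw [Ideal.span_singleton_le_iff_mem]; exact h
    · intro e
      apply hd
      rw [← Ideal.mem_span_singleton, e]; exact hH
  have l23 : p2 < p3 := by
    change RingHom.ker (th k b) < RingHom.ker ev
    refine lt_of_le_of_ne ?_ ?_
    · intro x hx
      rw [RingHom.mem_ker] at hx ⊢
      simp [ev, hx]
    · intro e
      have : (X 0 : MvPolynomial (Fin 2) K) ∈ RingHom.ker ev := by
        rw [RingHom.mem_ker]; simp [ev, th]
      rw [← e, RingHom.mem_ker] at this
      simp [th, h0] at this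
  let s : LTSeries (PrimeSpectrum (MvPolynomial (Fin 2) K)) :=
    { length := 3
      toFun := ![p0, p1, p2, p3]
      step := by
        intro i
        fin_cases i
        · exact l01
        · exact l12
        · exact l23 }
  have hs := Order.LTSeries.length_le_krullDim s
  have hd2 : ringKrullDim (MvPolynomial (Fin 2) K) = 2 := by
    rw [MvPolynomial.ringKrullDim_of_isNoetherianRing, ringKrullDim_eq_zero_of_field]
    simp
  rw [ringKrullDim] at hd2
  rw [hd2] at hs
  change ((3 : ℕ) : WithBot ℕ∞) ≤ ((2 : ℕ) : WithBot ℕ∞) at hs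
  have : (3 : ℕ) ≤ 2 := by exact_mod_cast hs
  omega


lemma t_cast (k t : ℕ) (hk : 2 ≤ k) (ht : t = 2 ^ (2 * k) - 2 ^ k + 1) : (t : K) = 1 ∧ 2 ≤ t := by
  have h2 : (2 : K) = 0 := CharTwo.two_eq_zero
  have h := (tnum k t ht).1
  constructor
  · have := congrArg (Nat.cast : ℕ → K) h
    push_cast at this
    rw [h2, zero_pow (by omega), zero_pow (by omega)] at this
    simpa using this
  · have : 2 ^ k < 2 ^ (2 * k) := Nat.pow_lt_pow_right (by norm_num) (by omega)
    omega

lemma root_fix (k t : ℕ) (hk : 2 ≤ k) (ht : t = 2 ^ (2 * k) - 2 ^ k + 1)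
    (phi : MvPolynomial (Fin 2) K)
    (hphi : phi * ((X 0 + X 1) * (X 0 + 1) * (X 1 + 1)) =
      X 0 ^ t + X 1 ^ t + 1 + (X 0 + X 1 + 1) ^ t) (x : K)
    (hx : eval (Fin.cons x (fun _ : Fin 1 => (0 : K))) phi = 0) :
    x ^ 2 ^ k = x ∧ x ≠ 0 ∧ x ≠ 1 := by
  have : Fact (Nat.Prime 2) := ⟨Nat.prime_two⟩
  have h2 : (2 : K) = 0 := CharTwo.two_eq_zero
  obtain ⟨tc, t2⟩ := t_cast (K := K) k t hk ht
  have h11 : (1 : K) + 1 = 0 := by linear_combination h2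
  refine ⟨?_, ?_, ?_⟩
  · have h := congrArg (eval (Fin.cons x (fun _ : Fin 1 => (0 : K)))) hphi
    have e0 : (Fin.cons x (fun _ : Fin 1 => (0 : K)) : Fin 2 → K) 1 = 0 := rfl
    have ex : (Fin.cons x (fun _ : Fin 1 => (0 : K)) : Fin 2 → K) 0 = x := rfl
    simp only [map_mul, hx, zero_mul, map_add, map_pow, eval_X, map_one, e0, ex, add_zero] at h
    rw [zero_pow (by omega), add_zero] at h
    have key : ∀ z : K, z ^ t * z ^ 2 ^ k = (z ^ 2 ^ k) ^ 2 ^ k * z := fun z => by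
      rw [← pow_add, (tnum k t ht).1, pow_succ, two_mul k, pow_add 2, pow_mul]
    have k1 := key x
    have k2 := key (x + 1)
    simp only [add_pow_char_pow, one_pow] at k2
    have hz : (x ^ 2 ^ k + x) ^ 2 ^ k * (x ^ 2 ^ k + x) = 0 := by
      rw [add_pow_char_pow]
      generalize x ^ 2 ^ k = u at *
      generalize u ^ 2 ^ k = w at *
      linear_combination (u * (u + 1)) * h + (u + 1) * k1 + u * k2 +
        (w * u + w * x + u ^ 2 + u * x + u + w * x * u) * h2
    rw [← pow_succ] at hz
    have := pow_eq_zero_iff (by positivity) |>.mp hz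
    exact CharTwo.add_eq_zero.mp this
  · rintro rfl
    have h := congrArg (fun p => eval (Fin.cons 0 (fun _ : Fin 1 => (0 : K))) (pderiv 0 p)) hphi
    have e0 : (Fin.cons 0 (fun _ : Fin 1 => (0 : K)) : Fin 2 → K) 1 = 0 := rfl
    have ex : (Fin.cons 0 (fun _ : Fin 1 => (0 : K)) : Fin 2 → K) 0 = 0 := rfl
    simp [Derivation.leibniz, Derivation.leibniz_pow, pderiv_X, hx, e0, ex, tc] at h
    rw [zero_pow (by omega)] at h
    simp at h
  · rintro rfl
    have h := congrArg (fun p => eval (Fin.cons 1 (fun _ : Fin 1 => (0 : K))) (pderiv 0 p)) hphi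
    have e0 : (Fin.cons 1 (fun _ : Fin 1 => (0 : K)) : Fin 2 → K) 1 = 0 := rfl
    have ex : (Fin.cons 1 (fun _ : Fin 1 => (0 : K)) : Fin 2 → K) 0 = 1 := rfl
    simp [Derivation.leibniz, Derivation.leibniz_pow, pderiv_X, hx, e0, ex, tc, h11] at h
    rw [zero_pow (by omega)] at h
    simp at h

lemma simple_pt (k t : ℕ) (hk : 2 ≤ k) (ht : t = 2 ^ (2 * k) - 2 ^ k + 1)
    (P Q : MvPolynomial (Fin 2) K)
    (hphi : P * Q * ((X 0 + X 1) * (X 0 + 1) * (X 1 + 1)) =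
      X 0 ^ t + X 1 ^ t + 1 + (X 0 + X 1 + 1) ^ t) (x : K) (hx1 : x ≠ 1)
    (hP : eval (Fin.cons x (fun _ : Fin 1 => (0 : K))) P = 0)
    (hQ : eval (Fin.cons x (fun _ : Fin 1 => (0 : K))) Q = 0) : False := by
  obtain ⟨tc, t2⟩ := t_cast (K := K) k t hk ht
  have h := congrArg (fun p => eval (Fin.cons x (fun _ : Fin 1 => (0 : K))) (pderiv 1 p)) hphi
  have e0 : (Fin.cons x (fun _ : Fin 1 => (0 : K)) : Fin 2 → K) 1 = 0 := rfl
  have ex : (Fin.cons x (fun _ : Fin 1 => (0 : K)) : Fin 2 → K) 0 = x := rfl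
  simp [Derivation.leibniz, Derivation.leibniz_pow, pderiv_X, hP, hQ, e0, ex, tc] at h
  rw [zero_pow (by omega), zero_add] at h
  have := pow_eq_zero_iff (by omega) |>.mp h.symm
  exact hx1 (CharTwo.add_eq_zero.mp this)

lemma lc_f {R : Type*} [CommRing R] [Nontrivial R] (t : ℕ) (ht : (t : R) = 1) (t2 : 2 ≤ t) (c d : R) (hc : c ≠ 0)
    [CharP R 2] :
    (Polynomial.X ^ t + Polynomial.C d + (Polynomial.X + Polynomial.C c) ^ t).leadingCoeff = c := by
  have hcoef : (Polynomial.X ^ t + Polynomial.C d + (Polynomial.X + Polynomial.C c) ^ t).coeff (t - 1) = c := by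
    obtain ⟨m, rfl⟩ : ∃ m, t = m + 1 := ⟨t - 1, by omega⟩
    rw [Polynomial.coeff_add, Polynomial.coeff_add, Polynomial.coeff_X_add_C_pow, Polynomial.coeff_X_pow,
      Polynomial.coeff_C]
    have : m ≠ 0 := by omega
    simp [this] at ht ⊢
    rw [ht, zero_add, mul_one]
  have hdeg : (Polynomial.X ^ t + Polynomial.C d + (Polynomial.X + Polynomial.C c) ^ t).natDegree = t - 1 := by
    refine Polynomial.natDegree_eq_of_le_of_coeff_ne_zero ?_ (by rw [hcoef]; exact hc)
    rw [Polynomial.natDegree_le_iff_coeff_eq_zero]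
    intro N hN
    rw [Polynomial.coeff_add, Polynomial.coeff_add, Polynomial.coeff_X_add_C_pow, Polynomial.coeff_X_pow,
      Polynomial.coeff_C, if_neg (by omega : ¬ N = 0)]
    by_cases h : N = t
    · subst h; simp [CharTwo.add_self_eq_zero]
    · rw [Nat.choose_eq_zero_of_lt (by omega)]; simp [h]
  rw [Polynomial.leadingCoeff, hdeg, hcoef]

lemma exists_root [IsAlgClosed K] (k t : ℕ) (hk : 2 ≤ k) (ht : t = 2 ^ (2 * k) - 2 ^ k + 1)
    (P Q : MvPolynomial (Fin 2) K) (hP : Irreducible P)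
    (hphi : P * Q * ((X 0 + X 1) * (X 0 + 1) * (X 1 + 1)) =
      X 0 ^ t + X 1 ^ t + 1 + (X 0 + X 1 + 1) ^ t) :
    ∃ x : K, eval (Fin.cons x (fun _ : Fin 1 => (0 : K))) P = 0 := by
  obtain ⟨tc', t2⟩ := t_cast (K := K) k t hk ht
  have tc : (t : MvPolynomial (Fin 1) K) = 1 := by rw [← map_natCast C, tc', map_one]
  have hc : (X 0 + 1 : MvPolynomial (Fin 1) K) ≠ 0 := by
    intro h
    have := congrArg (eval (fun _ => (0 : K))) h
    simp at this
  have h := congrArg (finSuccEquiv K 1) hphi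
  have X1 : finSuccEquiv K 1 (X 1) = Polynomial.C (X 0) := finSuccEquiv_X_succ (j := 0)
  simp only [map_mul, map_add, map_pow, finSuccEquiv_X_zero, X1, map_one] at h
  have h' := congrArg Polynomial.leadingCoeff h
  have hr : (Polynomial.X ^ t + Polynomial.C (X 0) ^ t + 1 + (Polynomial.X + Polynomial.C (X 0) + 1) ^ t :
      Polynomial (MvPolynomial (Fin 1) K)) = Polynomial.X ^ t + Polynomial.C (X 0 ^ t + 1) +
      (Polynomial.X + Polynomial.C (X 0 + 1)) ^ t := by
    simp only [Polynomial.C_add, Polynomial.C_pow, Polynomial.C_1, add_assoc]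
  have hl : (Polynomial.C (X 0) + 1 : Polynomial (MvPolynomial (Fin 1) K)) = Polynomial.C (X 0 + 1) := by
    simp only [Polynomial.C_add, Polynomial.C_1]
  have hl1 : (Polynomial.X + 1 : Polynomial (MvPolynomial (Fin 1) K)).leadingCoeff = 1 := by
    rw [← Polynomial.C_1]; exact Polynomial.leadingCoeff_X_add_C _
  rw [hr, lc_f t tc t2 _ _ hc, hl] at h'
  simp only [Polynomial.leadingCoeff_mul, Polynomial.leadingCoeff_X_add_C, hl1,
    Polynomial.leadingCoeff_C, one_mul] at h'
  have hu := mul_right_cancel₀ hc (h'.trans (one_mul _).symm)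
  have hunit : IsUnit ((finSuccEquiv K 1 P).leadingCoeff) := IsUnit.of_mul_eq_one _ hu
  have hnd : (Polynomial.map (eval (fun _ : Fin 1 => (0 : K))) (finSuccEquiv K 1 P)).natDegree =
      (finSuccEquiv K 1 P).natDegree :=
    Polynomial.natDegree_map_of_leadingCoeff_ne_zero _ (hunit.map _).ne_zero
  have hne : (finSuccEquiv K 1 P).natDegree ≠ 0 := by
    intro h0
    apply hP.not_isUnit
    rw [← isUnit_map_iff (finSuccEquiv K 1), Polynomial.eq_C_of_natDegree_eq_zero h0]
    rw [Polynomial.leadingCoeff, h0] at hunit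
    exact hunit.map Polynomial.C
  obtain ⟨x, hx⟩ := IsAlgClosed.exists_root
    (Polynomial.map (eval (fun _ : Fin 1 => (0 : K))) (finSuccEquiv K 1 P))
    (fun h0 => hne (by rw [← hnd]; exact Polynomial.natDegree_eq_of_degree_eq_some h0))
  exact ⟨x, by rw [eval_eq_eval_mv_eval']; exact hx⟩

lemma exists_b [IsAlgClosed K] (k t : ℕ) (hk : 2 ≤ k) (ht : t = 2 ^ (2 * k) - 2 ^ k + 1)
    (phi P : MvPolynomial (Fin 2) K) (hP : Irreducible P) (hd : P ∣ phi)
    (hphi : phi * ((X 0 + X 1) * (X 0 + 1) * (X 1 + 1)) =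
      X 0 ^ t + X 1 ^ t + 1 + (X 0 + X 1 + 1) ^ t) :
    ∃ b : K, b ^ 2 ^ k = b ∧ b ≠ 0 ∧ b ≠ 1 ∧ th k b P = 0 := by
  have h2 : (2 : K) = 0 := CharTwo.two_eq_zero
  have h11 : (1 : K) + 1 = 0 := by linear_combination h2
  obtain ⟨Q, rfl⟩ := hd
  obtain ⟨x, hx⟩ := exists_root k t hk ht P Q hP hphi
  obtain ⟨f, x0, x1⟩ := root_fix k t hk ht _ hphi x (by rw [map_mul, hx, zero_mul])
  obtain ⟨b, hb⟩ := IsAlgClosed.exists_pow_nat_eq (x⁻¹) (n := 2) (by norm_num)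
  have hb0 : b ≠ 0 := by
    rintro rfl
    simp at hb
    exact x0 hb.symm
  have hb1 : b ≠ 1 := by
    rintro rfl
    simp at hb
    exact x1 hb
  have hbq : b ^ 2 ^ k = b := by
    apply CharTwo.sq_injective
    change (b ^ 2 ^ k) ^ 2 = b ^ 2
    rw [← pow_mul, mul_comm, pow_mul, hb, inv_pow, f]
  refine ⟨b, hbq, hb0, hb1, ?_⟩
  have h := th_phi k t ht b hbq hb0 hb1 _ hphi
  rw [map_mul] at h
  refine (mul_eq_zero.mp h).resolve_right ?_
  intro h
  have := congrArg (Polynomial.eval 1) h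
  rw [eval_th, h11, hb, zero_pow (by positivity), Polynomial.eval_zero] at this
  simp only [inv_inv, one_pow, mul_one, mul_zero] at this
  exact simple_pt k t hk ht P Q hphi x x1 hx this

lemma eval_th_one (k : ℕ) (b : K) (hb : b ^ 2 ^ k = b) (h0 : b ≠ 0) (h1 : b ≠ 1)
    (P : MvPolynomial (Fin 2) K) : Polynomial.eval b (th k b P) = eval (fun _ => 1) P := by
  have : Fact (Nat.Prime 2) := ⟨Nat.prime_two⟩
  have h2 : (2 : K) = 0 := CharTwo.two_eq_zero
  have hc1 := bsq h1
  rw [eval_th]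
  congr 2
  rw [pow_succ b (2 ^ k), pow_succ (b + 1) (2 ^ k), add_pow_char_pow, hb, one_pow]
  have e1 : (b ^ 2)⁻¹ * (b * b) = 1 := by field_simp
  have e2 : (b ^ 2 + 1)⁻¹ * ((b + 1) * (b + 1)) = 1 := by
    rw [show (b + 1) * (b + 1) = b ^ 2 + 1 by linear_combination b * h2]
    exact inv_mul_cancel₀ hc1
  rw [e1, e2]
  funext i
  fin_cases i <;> rfl

lemma local_facts (k : ℕ) (hk : 2 ≤ k) (P : MvPolynomial (Fin 2) K) (hP : Irreducible P)
    (b : K) (hb : b ^ 2 ^ k = b) (h0 : b ≠ 0) (h1 : b ≠ 1) (h : th k b P = 0) :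
    eval (fun _ => 1) P = 0 ∧
    (eval (fun _ => 1) (pderiv 0 P) ≠ 0 ∨ eval (fun _ => 1) (pderiv 1 P) ≠ 0) ∧
    eval (fun _ => 1) (pderiv 0 P) * (b + 1) = eval (fun _ => 1) (pderiv 1 P) * b := by
  have : Fact (Nat.Prime 2) := ⟨Nat.prime_two⟩
  have h2 : (2 : K) = 0 := CharTwo.two_eq_zero
  have hz : eval (fun _ => 1) P = 0 := by rw [← eval_th_one k b hb h0 h1, h, Polynomial.eval_zero]
  refine ⟨hz, ?_, ?_⟩
  · obtain ⟨H, hH⟩ := dvd_of_th k b h0 P (G k b) hP h (th_G k b h0 h1)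
    have hg := grad_G k hk b h0 h1
    rw [hH] at hg
    by_contra! hn
    simp [Derivation.leibniz, hz, hn.1, hn.2] at hg
  · have hq : (2 : K) ^ k = 0 := by rw [h2, zero_pow (by omega)]
    have hc := chain ![Polynomial.C ((b ^ 2)⁻¹) * Polynomial.X ^ (2 ^ k + 1),
      Polynomial.C ((b ^ 2 + 1)⁻¹) * (Polynomial.X + 1) ^ (2 ^ k + 1)] P
    change Polynomial.derivative (th k b P) = th k b _ * _ + th k b _ * _ at hc
    rw [h] at hc
    have he := congrArg (Polynomial.eval b) hc
    rw [Polynomial.eval_add, Polynomial.eval_mul, Polynomial.eval_mul, eval_th_one k b hb h0 h1,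
      eval_th_one k b hb h0 h1] at he
    simp [Polynomial.derivative_pow, hq, hb, add_pow_char_pow] at he
    have hc1 := bsq h1
    have hb1 : b + 1 ≠ 0 := fun h => h1 (CharTwo.add_eq_zero.mp h)
    rw [show b ^ 2 + 1 = (b + 1) ^ 2 by linear_combination - b * h2] at he
    field_simp at he
    linear_combination (-1) * he - b * eval (fun _ => 1) (pderiv 1 P) * h2

end Kas

/-- For the Kasami–Welch number `t = 2^(2k) - 2^k + 1` (k ≥ 2), the absolutely
irreducible components of `φ_t(x,y)` intersect transversally at `p = (1,1)`: every irreducible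
factor `P` of `φ_t(x,y)` over an algebraic closure of `F_2` vanishes at `(1,1)` and has nonzero
gradient there, and two non-associated irreducible factors have non-proportional gradients
at `(1,1)`.  Here `φ_t(x,y)` is the (unique) quotient of `x^t + y^t + 1 + (x+y+1)^t`
by `(x+y)(x+1)(y+1)` in `F_2[x,y]`. -/
theorem kasami_components_transversal (k : ℕ) (hk : 2 ≤ k) (t : ℕ)
    (ht : t = 2 ^ (2 * k) - 2 ^ k + 1)
    (phi : MvPolynomial (Fin 2) (ZMod 2))
    (hphi : phi * ((X 0 + X 1) * (X 0 + 1) * (X 1 + 1)) =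
      X 0 ^ t + X 1 ^ t + 1 + (X 0 + X 1 + 1) ^ t) :
    (∀ P : MvPolynomial (Fin 2) (AlgebraicClosure (ZMod 2)), Irreducible P →
      P ∣ MvPolynomial.map (algebraMap (ZMod 2) (AlgebraicClosure (ZMod 2))) phi →
      MvPolynomial.eval (fun _ => 1) P = 0 ∧
      (MvPolynomial.eval (fun _ => 1) (pderiv 0 P) ≠ 0 ∨
       MvPolynomial.eval (fun _ => 1) (pderiv 1 P) ≠ 0)) ∧
    (∀ P P' : MvPolynomial (Fin 2) (AlgebraicClosure (ZMod 2)), Irreducible P → Irreducible P' →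
      P ∣ MvPolynomial.map (algebraMap (ZMod 2) (AlgebraicClosure (ZMod 2))) phi →
      P' ∣ MvPolynomial.map (algebraMap (ZMod 2) (AlgebraicClosure (ZMod 2))) phi →
      ¬ Associated P P' →
      MvPolynomial.eval (fun _ => 1) (pderiv 0 P) * MvPolynomial.eval (fun _ => 1) (pderiv 1 P') ≠
      MvPolynomial.eval (fun _ => 1) (pderiv 1 P) * MvPolynomial.eval (fun _ => 1) (pderiv 0 P')) := by
  have hphi' := congrArg (MvPolynomial.map (algebraMap (ZMod 2) (AlgebraicClosure (ZMod 2)))) hphi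
  simp only [map_mul, map_add, map_pow, map_X, map_one] at hphi'
  generalize MvPolynomial.map (algebraMap (ZMod 2) (AlgebraicClosure (ZMod 2))) phi = Phi at *
  constructor
  · intro P hP hd
    obtain ⟨b, hb, h0, h1, h⟩ := Kas.exists_b k t hk ht Phi P hP hd hphi'
    obtain ⟨a1, a2, -⟩ := Kas.local_facts k hk P hP b hb h0 h1 h
    exact ⟨a1, a2⟩
  · intro P P' hP hP' hd hd' hna heq
    have h2 : (2 : AlgebraicClosure (ZMod 2)) = 0 := CharTwo.two_eq_zero
    obtain ⟨b, hb, h0, h1, h⟩ := Kas.exists_b k t hk ht Phi P hP hd hphi'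
    obtain ⟨-, a2, a3⟩ := Kas.local_facts k hk P hP b hb h0 h1 h
    obtain ⟨b', hb', h0', h1', h'⟩ := Kas.exists_b k t hk ht Phi P' hP' hd' hphi'
    obtain ⟨-, c2, c3⟩ := Kas.local_facts k hk P' hP' b' hb' h0' h1' h'
    have hbb : b = b' := by
      generalize MvPolynomial.eval (fun _ => 1) (pderiv 0 P) = u at *
      generalize MvPolynomial.eval (fun _ => 1) (pderiv 1 P) = v at *
      generalize MvPolynomial.eval (fun _ => 1) (pderiv 0 P') = u' at *
      generalize MvPolynomial.eval (fun _ => 1) (pderiv 1 P') = v' at *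
      have e1 : u = (u + v) * b := by linear_combination a3 - u * b * h2
      have e2 : v = (u + v) * (b + 1) := by linear_combination (-1) * a3 - v * b * h2
      have e3 : u' = (u' + v') * b' := by linear_combination c3 - u' * b' * h2
      have e4 : v' = (u' + v') * (b' + 1) := by linear_combination (-1) * c3 - v' * b' * h2
      have s1 : u + v ≠ 0 := by
        intro hs
        rw [hs, zero_mul] at e1 e2
        rcases a2 with h | h
        · exact h e1
        · exact h e2
      have s2 : u' + v' ≠ 0 := by
        intro hs
        rw [hs, zero_mul] at e3 e4
        rcases c2 with h | h
        · exact h e3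
        · exact h e4
      have hz : ((u + v) * (u' + v')) * (b - b') = 0 := by
        linear_combination heq - v' * e1 - ((u + v) * b) * e4 + u' * e2 + ((u + v) * (b + 1)) * e3
      exact sub_eq_zero.mp ((mul_eq_zero.mp hz).resolve_left (mul_ne_zero s1 s2))
    subst hbb
    exact hna (hP.associated_of_dvd hP' (Kas.dvd_of_th k b h0 P P' hP h h'))
end

section
/- Let L = F_{2^n}, let k ≥ 2, let t = 2^{2k} − 2^k + 1 be the Kasami–Welch number, and let f(x) = x^t + h(x) ∈ L[x], where h is a polynomial with 3 ≤ deg(h) < t and deg(h) ≡ 3 (mod 4). Then f is not exceptional APN: there are only finitely many m ≥ 1 such that f is APN on F_{2^{nm}}. -/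
/-- `g` is almost perfect nonlinear (APN) on the field `K`: for all `a ≠ 0` and all `b`,
the equation `g(x+a) + g(x) = b` has at most two solutions. -/
def IsAPN {K : Type} [Field K] (g : K → K) : Prop :=
  ∀ a b : K, a ≠ 0 → {x : K | g (x + a) + g x = b}.ncard ≤ 2

namespace KW
open Polynomial

lemma natDegree_det_le' {K : Type*} [CommRing K] {n : Type*} [Fintype n] [DecidableEq n]
    (A : Matrix n n K[X]) (b : ℕ) (h : ∀ i j, (A i j).natDegree ≤ b) :
    A.det.natDegree ≤ Fintype.card n * b := by
  rw [Matrix.det_apply]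
  refine natDegree_sum_le_of_forall_le _ _ fun σ _ => ?_
  refine (natDegree_smul_le _ _).trans ?_
  refine (natDegree_prod_le _ _).trans ?_
  calc _ ≤ ∑ i : n, b := Finset.sum_le_sum fun i _ => h _ _
    _ = _ := by simp

lemma norm_lemma {K : Type*} [Field K] (P s : K[X][X]) (D c B : ℕ) (hP : Irreducible P)
    (hm : P.Monic) (hD : P.natDegree = D) (hs0 : s ≠ 0) (hs : s.natDegree < D)
    (hC : ∀ l, (P.coeff l).natDegree ≤ c) (hB : ∀ l, (s.coeff l).natDegree ≤ B) :
    ∃ ρ : K[X], ρ ≠ 0 ∧ ρ.natDegree ≤ (2 * D) * (B + c) ∧ ∃ u v, s * u + P * v = C ρ := by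
  refine ⟨s.resultant P, ?_, ?_, ?_⟩
  · intro h0
    have hinj : Function.Injective (algebraMap K[X] (FractionRing K[X])) :=
      IsFractionRing.injective _ _
    have h1 : resultant (s.map (algebraMap K[X] (FractionRing K[X])))
        (P.map (algebraMap K[X] (FractionRing K[X]))) = 0 := by
      rw [natDegree_map_eq_of_injective hinj, natDegree_map_eq_of_injective hinj,
        resultant_map_map, h0, map_zero]
    rw [resultant_eq_zero_iff] at h1
    apply h1.2
    have hirr := (hm.irreducible_iff_irreducible_map_fraction_map (K := FractionRing K[X])).1 hP
    refine ((hirr.coprime_iff_not_dvd).2 fun hdvd => ?_).symm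
    have := natDegree_le_of_dvd hdvd
      ((Polynomial.map_ne_zero_iff hinj).2 hs0)
    rw [natDegree_map_eq_of_injective hinj, natDegree_map_eq_of_injective hinj] at this
    omega
  · refine (natDegree_det_le' _ (B + c) ?_).trans ?_
    · intro i j
      refine Fin.addCases (fun j => ?_) (fun j => ?_) j
      · simp only [sylvester, Matrix.of_apply, Fin.addCases_left]
        split_ifs
        · exact (hC _).trans (by omega)
        · simp
      · simp only [sylvester, Matrix.of_apply, Fin.addCases_right]
        split_ifs
        · exact (hB _).trans (by omega)
        · simp
    · rw [Fintype.card_fin]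
      exact Nat.mul_le_mul_right _ (by omega)
  · obtain ⟨p, q, -, -, h⟩ := exists_mul_add_mul_eq_C_resultant s P le_rfl le_rfl
      (Or.inr (by omega : P.natDegree ≠ 0))
    exact ⟨p, q, h⟩

lemma exists_algHom_of_finiteType {k S : Type*} [Field k] [IsAlgClosed k] [CommRing S]
    [Nontrivial S] [Algebra k S] [Algebra.FiniteType k S] : Nonempty (S →ₐ[k] k) := by
  obtain ⟨m, hm⟩ := Ideal.exists_maximal S
  let := Ideal.Quotient.field m
  have := finite_of_finite_type_of_isJacobsonRing k (S ⧸ m)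
  have hb := IsAlgClosed.algebraMap_bijective_of_isIntegral (k := k) (K := S ⧸ m)
  exact ⟨((AlgEquiv.ofBijective (Algebra.ofId k (S ⧸ m)) hb).symm : (S ⧸ m) →ₐ[k] k).comp
    (Ideal.Quotient.mkₐ k m)⟩

lemma geom_irred {k L : Type*} [Field k] [IsAlgClosed k] [Field L] [Algebra k L] (P : k[X][X])
    (hP : Irreducible P) (hm : P.Monic) :
    Irreducible (P.map (mapRingHom (algebraMap k L))) := by
  have hmL := hm.map (mapRingHom (algebraMap k L))
  rw [hmL.irreducible_iff_natDegree]
  rw [hm.irreducible_iff_natDegree] at hP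
  have hinj : Function.Injective (mapRingHom (algebraMap k L)) :=
    map_injective _ (algebraMap k L).injective
  refine ⟨fun h => hP.1 ?_, fun f g hf hg hfg => ?_⟩
  · exact map_injective _ hinj (by rw [h, Polynomial.map_one])
  classical
  let cs : Finset L := (f.support.biUnion fun i => (f.coeff i).support.image fun j => (f.coeff i).coeff j) ∪
    (g.support.biUnion fun i => (g.coeff i).support.image fun j => (g.coeff i).coeff j)
  let S := Algebra.adjoin k (cs : Set L)
  have hft : Algebra.FiniteType k S := (Subalgebra.fg_iff_finiteType S).1 ⟨cs, rfl⟩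
  obtain ⟨ψ⟩ := exists_algHom_of_finiteType (k := k) (S := S)
  have hinS : Function.Injective (mapRingHom (algebraMap S L)) :=
    map_injective _ Subtype.val_injective
  have lift : ∀ f : L[X][X], f.Monic → (∀ i j, (f.coeff i).coeff j ∈ S) →
      ∃ f' : S[X][X], f'.Monic ∧ f'.map (mapRingHom (algebraMap S L)) = f := by
    intro f hf h
    have : f ∈ lifts (mapRingHom (algebraMap S L)) := by
      rw [lifts_iff_coeff_lifts]
      intro i
      have : f.coeff i ∈ lifts (algebraMap S L) := by
        rw [lifts_iff_coeff_lifts]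
        intro j
        exact ⟨⟨_, h i j⟩, rfl⟩
      obtain ⟨p, hp⟩ := (mem_lifts _).1 this
      exact ⟨p, by simpa using hp⟩
    obtain ⟨f', h1⟩ := (mem_lifts _).1 this
    refine ⟨f', ?_, h1⟩
    rw [← h1] at hf
    exact monic_of_injective hinS hf
  obtain ⟨f', hf'm, hf'⟩ := lift f hf (by
    intro i j
    by_cases h0 : (f.coeff i).coeff j = 0
    · rw [h0]; exact S.zero_mem
    · apply Algebra.subset_adjoin
      simp only [cs, Finset.coe_union, Set.mem_union, Finset.mem_coe, Finset.mem_biUnion, Finset.mem_image, mem_support_iff]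
      exact Or.inl ⟨i, fun h => h0 (by rw [h]; simp), j, h0, rfl⟩)
  obtain ⟨g', hg'm, hg'⟩ := lift g hg (by
    intro i j
    by_cases h0 : (g.coeff i).coeff j = 0
    · rw [h0]; exact S.zero_mem
    · apply Algebra.subset_adjoin
      simp only [cs, Finset.coe_union, Set.mem_union, Finset.mem_coe, Finset.mem_biUnion, Finset.mem_image, mem_support_iff]
      exact Or.inr ⟨i, fun h => h0 (by rw [h]; simp), j, h0, rfl⟩)
  have hprod : f' * g' = P.map (mapRingHom (algebraMap k S)) := by
    apply map_injective _ hinS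
    rw [Polynomial.map_mul, hf', hg', hfg, Polynomial.map_map, mapRingHom_comp]
    rfl
  have h2 := congrArg (Polynomial.map (mapRingHom (ψ : S →+* k))) hprod
  rw [Polynomial.map_mul, Polynomial.map_map, mapRingHom_comp, AlgHom.comp_algebraMap] at h2
  have h3 := hP.2 (f'.map (mapRingHom (ψ : S →+* k))) (g'.map (mapRingHom (ψ : S →+* k)))
    (hf'm.map _) (hg'm.map _) (by rw [h2]; ext; simp)
  rw [hf'm.natDegree_map, hg'm.natDegree_map] at h3
  rw [← hf', ← hg', hf'm.natDegree_map, hg'm.natDegree_map]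
  exact h3

end KW

namespace KW
open Polynomial

lemma sum_range_two_mul' {M : Type*} [AddCommMonoid M] (f : ℕ → M) (n : ℕ) :
    ∑ i ∈ Finset.range (2 * n), f i
      = ∑ i ∈ Finset.range n, f (2 * i) + ∑ i ∈ Finset.range n, f (2 * i + 1) := by
  induction n with
  | zero => simp
  | succ n ih =>
    rw [show 2 * (n + 1) = 2 * n + 1 + 1 by ring, Finset.sum_range_succ, Finset.sum_range_succ, ih,
      Finset.sum_range_succ, Finset.sum_range_succ]
    abel

lemma frob_indep {L : Type*} [Field L] [CharP L 2] (x : L) (hx : ∀ θ : L, θ ^ 2 ≠ x) (ν : ℕ) :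
    ∀ c : ℕ → L, ∑ m ∈ Finset.range (2 ^ ν), c m ^ (2 ^ ν) * x ^ m = 0 →
      ∀ m < 2 ^ ν, c m = 0 := by
  induction ν with
  | zero => intro c h m hm; simp at hm h; subst hm; simpa using h
  | succ ν ih =>
    intro c h
    have hE : ∀ c' : ℕ → L, (∑ m ∈ Finset.range (2 ^ ν), c' m ^ (2 ^ ν) * x ^ m) ^ 2
        = ∑ m ∈ Finset.range (2 ^ ν), c' m ^ (2 ^ (ν + 1)) * x ^ (2 * m) := by
      intro c'
      rw [sum_pow_char]
      refine Finset.sum_congr rfl fun m _ => ?_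
      rw [mul_pow, ← pow_mul, ← pow_mul, pow_succ, mul_comm m]
    rw [pow_succ, mul_comm (2 ^ ν) 2, sum_range_two_mul'] at h
    set E := ∑ m ∈ Finset.range (2 ^ ν), c (2 * m) ^ (2 ^ ν) * x ^ m with hEd
    set O := ∑ m ∈ Finset.range (2 ^ ν), c (2 * m + 1) ^ (2 ^ ν) * x ^ m with hOd
    have h1 : E ^ 2 + x * O ^ 2 = 0 := by
      rw [hEd, hOd, hE fun m => c (2 * m), hE fun m => c (2 * m + 1), ← h, Finset.mul_sum]
      simp only [pow_succ (2 : ℕ) ν, mul_comm (2 ^ ν) 2]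
      congr 1
      refine Finset.sum_congr rfl fun m _ => ?_
      ring
    have hO : O = 0 := by
      by_contra hO
      apply hx (E / O)
      rw [div_pow, div_eq_iff (pow_ne_zero _ hO)]
      have := eq_neg_of_add_eq_zero_left h1
      rwa [CharTwo.neg_eq] at this
    have hE0 : E = 0 := by
      rw [hO] at h1; simpa using h1
    intro m hm
    rcases Nat.even_or_odd' m with ⟨j, rfl | rfl⟩
    · exact ih (fun m => c (2 * m)) hE0 j (by rw [pow_succ] at hm; omega)
    · exact ih (fun m => c (2 * m + 1)) hO j (by rw [pow_succ] at hm; omega)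

end KW

namespace KW
open Polynomial

lemma X_not_sq {k : Type*} [Field k] (z : FractionRing k[X])
    (hz : z ^ 2 = algebraMap k[X] (FractionRing k[X]) X) : False := by
  have hintg : IsIntegral k[X] z := by
    refine ⟨X ^ 2 - C X, by monicity!, ?_⟩
    simp [hz]
  obtain ⟨p, rfl⟩ := IsIntegrallyClosed.isIntegral_iff.mp hintg
  rw [← map_pow] at hz
  have := IsFractionRing.injective k[X] (FractionRing k[X]) hz
  have := congrArg natDegree this
  rw [natDegree_pow, natDegree_X] at this
  omega

lemma ff_pkg {k : Type} [Field k] [CharP k 2] (P : k[X][X]) (hP : Irreducible P)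
    (hm : P.Monic) (hd : derivative P ≠ 0) :
    ∃ (L : Type) (_ : Field L) (_ : Algebra k L) (x y : L),
      eval₂ (eval₂RingHom (algebraMap k L) x) y P = 0 ∧
      (∀ R : k[X][X], R.natDegree < P.natDegree →
        eval₂ (eval₂RingHom (algebraMap k L) x) y R = 0 → R = 0) ∧
      ∀ θ : L, θ ^ 2 ≠ x := by
  let K := FractionRing k[X]
  let P' : K[X] := P.map (algebraMap k[X] K)
  have hP' : Irreducible P' := (hm.irreducible_iff_irreducible_map_fraction_map).mp hP
  have : Fact (Irreducible P') := ⟨hP'⟩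
  have hm' : P'.Monic := hm.map _
  have hinj : Function.Injective (algebraMap k[X] K) := IsFractionRing.injective k[X] K
  let L := AdjoinRoot P'
  let φ : k →+* L := (algebraMap K L).comp ((algebraMap k[X] K).comp C)
  let x : L := algebraMap K L (algebraMap k[X] K X)
  have key : ∀ R : k[X][X], eval₂ (eval₂RingHom φ x) (AdjoinRoot.root P') R
      = AdjoinRoot.mk P' (R.map (algebraMap k[X] K)) := by
    intro R
    have : eval₂RingHom φ x = (algebraMap K L).comp (algebraMap k[X] K) := by
      ext <;> simp [φ, x]
    rw [this, ← AdjoinRoot.aeval_eq, aeval_map_algebraMap, aeval_def]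
    rfl
  refine ⟨L, inferInstance, φ.toAlgebra, x, AdjoinRoot.root P', ?_, ?_, ?_⟩
  · change eval₂ (eval₂RingHom φ x) _ _ = 0
    rw [key]; exact AdjoinRoot.mk_self
  · intro R hR h
    change eval₂ (eval₂RingHom φ x) _ _ = 0 at h
    rw [key, AdjoinRoot.mk_eq_zero] at h
    by_contra h0
    have h1 : R.map (algebraMap k[X] K) ≠ 0 := by
      rwa [Ne, Polynomial.map_eq_zero_iff hinj]
    have := natDegree_le_of_dvd h h1
    rw [natDegree_map_eq_of_injective hinj, natDegree_map_eq_of_injective hinj] at this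
    omega
  · intro θ hθ
    have hsep : P'.Separable := by
      rw [separable_iff_derivative_ne_zero hP', derivative_map]
      rwa [Ne, Polynomial.map_eq_zero_iff hinj]
    have hroot : IsSeparable K (AdjoinRoot.root P') := by
      rw [IsSeparable, AdjoinRoot.minpoly_root hP'.ne_zero, hm'.leadingCoeff]
      simpa using hsep
    have : Algebra.IsSeparable K L := by
      have h1 := (IntermediateField.isSeparable_adjoin_simple_iff_isSeparable K L).2 hroot
      have h2 : IntermediateField.adjoin K {AdjoinRoot.root P'} = ⊤ := by
        apply IntermediateField.adjoin_eq_top_of_algebra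
        exact AdjoinRoot.adjoinRoot_eq_top
      rw [h2] at h1
      exact (AlgEquiv.Algebra.isSeparable IntermediateField.topEquiv)
    have : CharP K 2 := charP_of_injective_algebraMap (R := k) (A := K) (algebraMap k K).injective 2
    have : ExpChar K 2 := ExpChar.prime Nat.prime_two
    have hmem : θ ∈ perfectClosure K L := by
      rw [mem_perfectClosure_iff_pow_mem 2]
      exact ⟨1, by rw [pow_one, hθ]; exact ⟨_, rfl⟩⟩
    rw [perfectClosure.eq_bot_of_isSeparable, IntermediateField.mem_bot] at hmem
    obtain ⟨z, rfl⟩ := hmem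
    rw [← map_pow] at hθ
    exact X_not_sq z ((algebraMap K L).injective hθ)

end KW

namespace KW
open Polynomial Finset

/-- bivariate polynomial with coefficient array `a` -/
noncomputable def bip {K : Type*} [CommRing K] (A D : ℕ) (a : ℕ → ℕ → K) : K[X][X] :=
  ∑ j ∈ range D, C (∑ i ∈ range A, C (a i j) * X ^ i) * X ^ j

lemma bip_coeff {K : Type*} [CommRing K] (A D : ℕ) (a : ℕ → ℕ → K) (i j : ℕ) (hi : i < A)
    (hj : j < D) : ((bip A D a).coeff j).coeff i = a i j := by
  simp only [bip, finsetSum_coeff, coeff_C_mul, coeff_X_pow, mul_ite, mul_one, mul_zero]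
  rw [Finset.sum_eq_single j]
  · simp only [if_true, finsetSum_coeff, coeff_C_mul, coeff_X_pow, mul_ite, mul_one, mul_zero]
    rw [Finset.sum_eq_single i]
    · simp
    · intro b _ hb; rw [if_neg (Ne.symm hb)]
    · intro h; exact absurd (Finset.mem_range.2 hi) h
  · intro b _ hb; rw [if_neg (Ne.symm hb), coeff_zero]
  · intro h; exact absurd (Finset.mem_range.2 hj) h

lemma bip_natDegree_lt {K : Type*} [CommRing K] (A D : ℕ) (hD : 0 < D) (a : ℕ → ℕ → K) :
    (bip A D a).natDegree < D := by
  have : (bip A D a).natDegree ≤ D - 1 := by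
    refine natDegree_sum_le_of_forall_le _ _ fun j hj => ?_
    refine (natDegree_C_mul_X_pow_le _ _).trans ?_
    have := Finset.mem_range.1 hj; omega
  omega

lemma bip_coeff_natDegree_le {K : Type*} [CommRing K] (A D : ℕ) (a : ℕ → ℕ → K) (l : ℕ) :
    ((bip A D a).coeff l).natDegree ≤ A := by
  simp only [bip, finsetSum_coeff, coeff_C_mul, coeff_X_pow, mul_ite, mul_one, mul_zero]
  refine natDegree_sum_le_of_forall_le _ _ fun j hj => ?_
  split_ifs
  · refine natDegree_sum_le_of_forall_le _ _ fun i hi => ?_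
    refine (natDegree_C_mul_X_pow_le _ _).trans (Finset.mem_range.1 hi).le
  · simp

lemma bip_eval₂ {K S : Type*} [CommRing K] [CommRing S] (φ : K →+* S) (x y : S) (A D : ℕ)
    (a : ℕ → ℕ → K) : eval₂ (eval₂RingHom φ x) y (bip A D a)
      = ∑ j ∈ range D, ∑ i ∈ range A, φ (a i j) * x ^ i * y ^ j := by
  simp only [bip, eval₂_finsetSum, eval₂_mul, eval₂_C, eval₂_X_pow, coe_eval₂RingHom,
    Finset.sum_mul]

/-- the auxiliary polynomial -/
noncomputable def AA {K : Type*} [CommRing K] (Q A B D : ℕ) (a : ℕ → ℕ → ℕ → ℕ → K) : K[X][X] :=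
  ∑ l ∈ range D, ∑ m ∈ range B, ∑ j ∈ range D, ∑ i ∈ range A,
    C (C (a i j m l) * X ^ (m + Q * i)) * X ^ (l + Q * j)

lemma AA_eval₂ {K S : Type*} [CommRing K] [CommRing S] (φ : K →+* S) (x y : S) (Q A B D : ℕ)
    (a : ℕ → ℕ → ℕ → ℕ → K) : eval₂ (eval₂RingHom φ x) y (AA Q A B D a)
      = ∑ l ∈ range D, ∑ m ∈ range B, ∑ j ∈ range D, ∑ i ∈ range A,
         φ (a i j m l) * x ^ (m + Q * i) * y ^ (l + Q * j) := by
  simp only [AA, eval₂_finsetSum, eval₂_mul, eval₂_C, eval₂_X_pow, coe_eval₂RingHom]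

lemma eval₂_eval₂_map {K L M : Type*} [CommRing K] [CommRing L] [CommRing M]
    (f : K →+* L) (g : L →+* M) (x y : M) (P : K[X][X]) :
    eval₂ (eval₂RingHom g x) y (P.map (mapRingHom f)) = eval₂ (eval₂RingHom (g.comp f) x) y P := by
  rw [eval₂_map]
  congr 1
  ext <;> simp

lemma indep {k : Type} [Field k] [CharP k 2] [IsAlgClosed k] (P : k[X][X]) (D c A B ν : ℕ)
    (hP : Irreducible P)
    (hm : P.Monic) (hd : derivative P ≠ 0) (hD : P.natDegree = D)
    (hC : ∀ l, (P.coeff l).natDegree ≤ c) (hν : 2 * D * (B + c) < 2 ^ ν)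
    (a : ℕ → ℕ → ℕ → ℕ → k) (hdvd : P ∣ AA (2 ^ ν) A B D a) :
    ∀ i < A, ∀ j < D, ∀ m < B, ∀ l < D, a i j m l = 0 := by
  obtain ⟨L, _, _, x, y, h1, h2, h3⟩ := ff_pkg P hP hm hd
  have : CharP L 2 := charP_of_injective_algebraMap (algebraMap k L).injective 2
  have hD0 : 0 < D := by
    rw [← hD]
    by_contra h0
    exact hd (by rw [eq_C_of_natDegree_eq_zero (by omega : P.natDegree = 0), derivative_C])
  let σ : k ≃+* k := (iterateFrobeniusEquiv k 2 ν).symm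
  have hσ : ∀ a, (σ a) ^ (2 ^ ν) = a := fun a => by
    have := (iterateFrobeniusEquiv k 2 ν).apply_symm_apply a
    rwa [iterateFrobeniusEquiv_apply, iterateFrobenius_def] at this
  let φ : k →+* L := algebraMap k L
  let b : ℕ → ℕ → L := fun m l => ∑ j ∈ range D, ∑ i ∈ range A, φ (σ (a i j m l)) * x ^ i * y ^ j
  let P1 : k[X][X] := P.map (mapRingHom (σ : k →+* k))
  have hP1 : Irreducible P1 := by
    have := (MulEquiv.irreducible_iff (Polynomial.mapEquiv (Polynomial.mapEquiv σ)) (x := P)).2 hP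
    have h7 : (Polynomial.mapEquiv (Polynomial.mapEquiv σ)) P = P1 := by
      simp only [P1, mapEquiv_apply]
      congr 1
    rwa [h7] at this
  have hm1 : P1.Monic := hm.map _
  let P2 : L[X][X] := P1.map (mapRingHom (algebraMap k L))
  have hP2 : Irreducible P2 := geom_irred P1 hP1 hm1
  have hm2 : P2.Monic := hm1.map _
  have hbz : bip B D b = 0 := by
    by_contra hs
    obtain ⟨ρ, hρ0, hρd, u, v, huv⟩ := norm_lemma P2 (bip B D b) D c B hP2 hm2
      (by rw [← hD, hm1.natDegree_map, hm.natDegree_map]) hs (bip_natDegree_lt _ _ hD0 _)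
      (by
        intro l
        simp only [P2, P1, coeff_map, coe_mapRingHom]
        exact (natDegree_map_le.trans natDegree_map_le).trans (hC l))
      (bip_coeff_natDegree_le _ _ _)
    let F := iterateFrobenius L 2 ν
    let Φ : L[X][X] →+* L := eval₂RingHom (eval₂RingHom F x) y
    have hFc : (F.comp φ).comp (σ : k →+* k) = φ := by
      ext z
      simp only [RingHom.comp_apply, F, iterateFrobenius_def]
      rw [← map_pow]
      congr 1
      exact hσ z
    have hΦP : Φ P2 = 0 := by
      change eval₂ (eval₂RingHom F x) y P2 = 0
      rw [eval₂_eval₂_map, eval₂_eval₂_map, hFc]; exact h1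
    have hΦs : Φ (bip B D b) = 0 := by
      change eval₂ (eval₂RingHom F x) y _ = 0
      have h4 : eval₂ (eval₂RingHom φ x) y (AA (2 ^ ν) A B D a) = 0 := by
        obtain ⟨w, hw⟩ := hdvd
        rw [hw, eval₂_mul, h1, zero_mul]
      rw [AA_eval₂] at h4
      rw [bip_eval₂, ← h4]
      refine Finset.sum_congr rfl fun l _ => Finset.sum_congr rfl fun m _ => ?_
      simp only [b, map_sum, Finset.sum_mul]
      refine Finset.sum_congr rfl fun j _ => Finset.sum_congr rfl fun i _ => ?_
      simp only [F, iterateFrobenius_def]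
      rw [mul_pow, mul_pow, ← map_pow, hσ]
      ring
    have hΦρ : Φ (C ρ) = 0 := by
      rw [← huv, map_add, map_mul, map_mul, hΦs, hΦP]; simp
    have hlt : ρ.natDegree < 2 ^ ν := lt_of_le_of_lt hρd hν
    have hsum : ∑ m ∈ range (2 ^ ν), ρ.coeff m ^ (2 ^ ν) * x ^ m = 0 := by
      rw [← hΦρ]
      simp only [Φ, coe_eval₂RingHom, eval₂_C]
      rw [eval₂_eq_sum_range' _ hlt]
      rfl
    have := frob_indep x h3 ν _ hsum
    apply hρ0
    ext m
    by_cases hmm : m < 2 ^ ν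
    · simpa using this m hmm
    · rw [coeff_eq_zero_of_natDegree_lt (by omega), coeff_zero]
  intro i hi j hj m hm' l hl
  have hb0 : b m l = 0 := by
    rw [← bip_coeff B D b m l hm' hl, hbz]; simp
  have h5 : bip A D (fun i j => σ (a i j m l)) = 0 := by
    apply h2
    · rw [hD]; exact bip_natDegree_lt _ _ hD0 _
    · rw [bip_eval₂]; exact hb0
  have h6 := bip_coeff A D (fun i j => σ (a i j m l)) i j hi hj
  rw [h5] at h6
  simpa using h6.symm

end KW

namespace KW
open Polynomial Finset

lemma X_pow_mod_deg {K : Type*} [Field K] (P : K[X][X]) (hm : P.Monic) (hD : 0 < P.natDegree)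
    (c : ℕ) (hC : ∀ l, (P.coeff l).natDegree ≤ c) (n : ℕ) :
    ∀ l, (((X : K[X][X]) ^ n %ₘ P).coeff l).natDegree ≤ n * c := by
  have hP1 : P ≠ 1 := by rintro rfl; simp at hD
  induction n with
  | zero =>
    intro l
    rw [pow_zero, (modByMonic_eq_self_iff hm).2, coeff_one]
    · split_ifs <;> simp
    · rw [degree_one]; exact natDegree_pos_iff_degree_pos.1 hD
  | succ n ih =>
    set r := (X : K[X][X]) ^ n %ₘ P with hr
    have hrd : r.natDegree < P.natDegree := natDegree_modByMonic_lt _ hm hP1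
    have h1 : (X : K[X][X]) ^ (n + 1) %ₘ P
        = X * r - C (r.coeff (P.natDegree - 1)) * P := by
      refine ((div_modByMonic_unique (X * ((X : K[X][X]) ^ n /ₘ P) + C (r.coeff (P.natDegree - 1)))
        (X * r - C (r.coeff (P.natDegree - 1)) * P) hm ⟨?_, ?_⟩)).2
      · have := modByMonic_add_div ((X : K[X][X]) ^ n) P
        rw [pow_succ, mul_comm _ X]
        conv_rhs => rw [← this]
        rw [← hr]
        ring
      · rw [degree_eq_natDegree hm.ne_zero, degree_lt_iff_coeff_zero]
        intro m hmm
        obtain ⟨m', rfl⟩ : ∃ m', m = m' + 1 := ⟨m - 1, by omega⟩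
        rw [coeff_sub, coeff_X_mul, coeff_C_mul]
        rcases eq_or_lt_of_le hmm with h | h
        · rw [← h, hm.coeff_natDegree, mul_one, h, Nat.add_sub_cancel, sub_self]
        · rw [coeff_eq_zero_of_natDegree_lt h, coeff_eq_zero_of_natDegree_lt (by omega)]; simp
    intro l
    rw [h1, coeff_sub, coeff_C_mul]
    refine (natDegree_sub_le _ _).trans (max_le ?_ ?_)
    · cases l with
      | zero => simp
      | succ l => rw [coeff_X_mul]; exact (ih l).trans (Nat.mul_le_mul_right _ (Nat.le_succ n))
    · refine natDegree_mul_le.trans ?_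
      rw [add_mul, one_mul]
      exact add_le_add (ih _) (hC l)

lemma mod_deg {K : Type*} [Field K] (P : K[X][X]) (hm : P.Monic) (hD : 0 < P.natDegree)
    (c : ℕ) (hC : ∀ l, (P.coeff l).natDegree ≤ c) (n b : ℕ) (g : K[X][X])
    (hg : g.natDegree ≤ n) (hb : ∀ l, (g.coeff l).natDegree ≤ b) (l : ℕ) :
    ((g %ₘ P).coeff l).natDegree ≤ b + n * c := by
  have h1 : g %ₘ P = ∑ i ∈ range (n + 1), C (g.coeff i) * ((X : K[X][X]) ^ i %ₘ P) := by
    conv_lhs => rw [g.as_sum_range_C_mul_X_pow' (Nat.lt_succ_of_le hg)]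
    rw [← modByMonicHom_apply, map_sum]
    refine Finset.sum_congr rfl fun i _ => ?_
    rw [modByMonicHom_apply, ← smul_eq_C_mul, ← smul_eq_C_mul, smul_modByMonic]
  rw [h1, finsetSum_coeff]
  refine natDegree_sum_le_of_forall_le _ _ fun i hi => ?_
  rw [coeff_C_mul]
  refine natDegree_mul_le.trans (add_le_add (hb i) ?_)
  refine (X_pow_mod_deg P hm hD c hC i l).trans (Nat.mul_le_mul_right _ ?_)
  have := Finset.mem_range.1 hi; omega

lemma divX_iter_coeff {R : Type*} [Semiring R] (P : R[X]) (j n : ℕ) :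
    (divX^[j] P).coeff n = P.coeff (n + j) := by
  induction j generalizing P with
  | zero => simp
  | succ j ih => rw [Function.iterate_succ_apply, ih, coeff_divX, add_assoc]

lemma horner {R : Type*} [CommRing R] (P : R[X]) (hm : P.Monic) (y z : R) :
    (z - y) * ∑ j ∈ range P.natDegree, (divX^[j + 1] P).eval y * z ^ j = P.eval z - P.eval y := by
  have hrec : ∀ j, (divX^[j] P).eval y = (divX^[j + 1] P).eval y * y + P.coeff j := by
    intro j
    conv_lhs => rw [← divX_mul_X_add (divX^[j] P)]
    rw [eval_add, eval_mul, eval_X, eval_C, divX_iter_coeff, zero_add,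
      Function.iterate_succ_apply']
  have key : ∀ n, (z - y) * ∑ j ∈ range n, (divX^[j + 1] P).eval y * z ^ j
      = (divX^[n] P).eval y * z ^ n + ∑ j ∈ range n, P.coeff j * z ^ j - P.eval y := by
    intro n
    induction n with
    | zero => simp
    | succ n ih =>
      rw [Finset.sum_range_succ, mul_add, ih, Finset.sum_range_succ, hrec n]
      ring
  rw [key]
  have h1 : divX^[P.natDegree] P = 1 := by
    ext n
    rw [divX_iter_coeff, coeff_one]
    split_ifs with h
    · subst h; rw [zero_add]; exact hm
    · exact coeff_eq_zero_of_natDegree_lt (by omega)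
  rw [h1, eval_eq_sum_range (p := P) z, Finset.sum_range_succ, hm.coeff_natDegree]
  simp
  ring

/-- the polynomials `W_j` -/
noncomputable def WW {K : Type*} [CommRing K] (M A B D : ℕ) (a : ℕ → ℕ → ℕ → ℕ → K) (j : ℕ) :
    K[X][X] :=
  ∑ l ∈ range D, ∑ m ∈ range B, ∑ i ∈ range A,
    C (C (a i j m l) * X ^ (M * m + i)) * X ^ (M * l)

lemma WW_eval₂ {K S : Type*} [CommRing K] [CommRing S] (φ : K →+* S) (x y : S) (M A B D : ℕ)
    (a : ℕ → ℕ → ℕ → ℕ → K) (j : ℕ) : eval₂ (eval₂RingHom φ x) y (WW M A B D a j)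
      = ∑ l ∈ range D, ∑ m ∈ range B, ∑ i ∈ range A,
         φ (a i j m l) * x ^ (M * m + i) * y ^ (M * l) := by
  simp only [WW, eval₂_finsetSum, eval₂_mul, eval₂_C, eval₂_X_pow, coe_eval₂RingHom]

lemma WW_add {K : Type*} [CommRing K] (M A B D : ℕ) (a b : ℕ → ℕ → ℕ → ℕ → K) (j : ℕ) :
    WW M A B D (a + b) j = WW M A B D a j + WW M A B D b j := by
  simp only [WW, Pi.add_apply, C_add, add_mul, Finset.sum_add_distrib]

lemma WW_smul {K : Type*} [CommRing K] (M A B D : ℕ) (c : K) (a : ℕ → ℕ → ℕ → ℕ → K) (j : ℕ) :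
    WW M A B D (c • a) j = (C c : K[X]) • WW M A B D a j := by
  simp only [WW, Pi.smul_apply, smul_eq_mul, C_mul, Finset.smul_sum, smul_eq_C_mul, mul_assoc]

lemma WW_natDegree {K : Type*} [CommRing K] (M A B D : ℕ) (a : ℕ → ℕ → ℕ → ℕ → K) (j : ℕ) :
    (WW M A B D a j).natDegree ≤ M * D := by
  refine natDegree_sum_le_of_forall_le _ _ fun l hl => natDegree_sum_le_of_forall_le _ _
    fun m _ => natDegree_sum_le_of_forall_le _ _ fun i _ =>
    (natDegree_C_mul_X_pow_le _ _).trans (Nat.mul_le_mul_left _ (Finset.mem_range.1 hl).le)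

lemma WW_coeff_natDegree {K : Type*} [CommRing K] (M A B D : ℕ) (a : ℕ → ℕ → ℕ → ℕ → K) (j n : ℕ) :
    ((WW M A B D a j).coeff n).natDegree ≤ M * B + A := by
  simp only [WW, finsetSum_coeff, coeff_C_mul, coeff_X_pow, mul_ite, mul_one, mul_zero]
  refine natDegree_sum_le_of_forall_le _ _ fun l hl => natDegree_sum_le_of_forall_le _ _
    fun m hm => natDegree_sum_le_of_forall_le _ _ fun i hi => ?_
  split_ifs
  · exact (natDegree_C_mul_X_pow_le _ _).trans
      (add_le_add (Nat.mul_le_mul_left _ (Finset.mem_range.1 hm).le) (Finset.mem_range.1 hi).le)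
  · simp

/-- extension by zero of a finite array -/
def ext4 {K : Type*} [Zero K] (A B D : ℕ) (v : Fin A × Fin D × Fin B × Fin D → K) :
    ℕ → ℕ → ℕ → ℕ → K := fun i j m l =>
  if h : i < A ∧ j < D ∧ m < B ∧ l < D then v (⟨i, h.1⟩, ⟨j, h.2.1⟩, ⟨m, h.2.2.1⟩, ⟨l, h.2.2.2⟩)
  else 0

lemma ext4_add {K : Type*} [AddMonoid K] (A B D : ℕ) (v w : Fin A × Fin D × Fin B × Fin D → K) :
    ext4 A B D (v + w) = ext4 A B D v + ext4 A B D w := by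
  funext i j m l
  simp only [ext4, Pi.add_apply]
  split_ifs <;> simp

lemma ext4_smul {K : Type*} [Semiring K] (A B D : ℕ) (c : K)
    (v : Fin A × Fin D × Fin B × Fin D → K) :
    ext4 A B D (c • v) = c • ext4 A B D v := by
  funext i j m l
  simp only [ext4, Pi.smul_apply]
  split_ifs <;> simp

lemma exists_arr {K : Type*} [Field K] (P : K[X][X]) (hm : P.Monic) (D c A B M E : ℕ)
    (hD : P.natDegree = D) (hD0 : 0 < D) (hC : ∀ l, (P.coeff l).natDegree ≤ c)
    (hE : E = M * B + A + c + (M * D + D) * c + 1)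
    (hdim : (D - 1) * D * E < A * D * B * D) :
    ∃ a : ℕ → ℕ → ℕ → ℕ → K, (∃ i < A, ∃ j < D, ∃ m < B, ∃ l < D, a i j m l ≠ 0) ∧
      ∀ j < D - 1, P ∣ WW M A B D a j - WW M A B D a (D - 1) * divX^[j + 1] P := by
  let G : (ℕ → ℕ → ℕ → ℕ → K) → ℕ → K[X][X] := fun a j =>
    WW M A B D a j - WW M A B D a (D - 1) * divX^[j + 1] P
  have hGadd : ∀ a b j, G (a + b) j = G a j + G b j := by
    intro a b j; simp only [G, WW_add]; ring
  have hGsmul : ∀ (r : K) a j, G (r • a) j = (C r : K[X]) • G a j := by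
    intro r a j; simp only [G, WW_smul, smul_sub, smul_mul_assoc]
  let T : (Fin A × Fin D × Fin B × Fin D → K) →ₗ[K] (Fin (D - 1) × Fin D × Fin E → K) :=
    { toFun := fun v p => ((G (ext4 A B D v) p.1 %ₘ P).coeff p.2.1).coeff p.2.2
      map_add' := by
        intro v w; funext p
        simp only [ext4_add, hGadd, add_modByMonic, coeff_add, Pi.add_apply]
      map_smul' := by
        intro r v; funext p
        simp only [ext4_smul, hGsmul, smul_modByMonic, coeff_smul, Pi.smul_apply, smul_eq_mul,
          RingHom.id_apply, coeff_C_mul] }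
  have hker : LinearMap.ker T ≠ ⊥ := by
    apply LinearMap.ker_ne_bot_of_finrank_lt
    simp only [Module.finrank_fintype_fun_eq_card, Fintype.card_prod, Fintype.card_fin]
    calc _ = (D - 1) * D * E := by ring
      _ < _ := hdim
      _ = _ := by ring
  obtain ⟨v, hv, hv0⟩ := (Submodule.ne_bot_iff _).1 hker
  refine ⟨ext4 A B D v, ?_, ?_⟩
  · obtain ⟨⟨i, j, m, l⟩, h⟩ := Function.ne_iff.1 hv0
    refine ⟨i, i.2, j, j.2, m, m.2, l, l.2, ?_⟩
    simpa [ext4] using h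
  · intro j hj
    change P ∣ G (ext4 A B D v) j
    rw [← modByMonic_eq_zero_iff_dvd hm]
    have hdeg : ∀ l, ((G (ext4 A B D v) j %ₘ P).coeff l).natDegree < E := by
      intro l
      have hdiv : ∀ n, ((divX^[j + 1] P).coeff n).natDegree ≤ c := fun n => by
        rw [divX_iter_coeff]; exact hC _
      have hdd : (divX^[j + 1] P).natDegree ≤ D := by
        rw [natDegree_le_iff_coeff_eq_zero]
        intro N hN
        rw [divX_iter_coeff]; exact coeff_eq_zero_of_natDegree_lt (by omega)
      have := mod_deg P hm (hD ▸ hD0) c hC (M * D + D) (M * B + A + c) (G (ext4 A B D v) j) ?_ ?_ l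
      · omega
      · refine (natDegree_sub_le _ _).trans (max_le ?_ ?_)
        · exact (WW_natDegree _ _ _ _ _ _).trans (by omega)
        · exact natDegree_mul_le.trans (add_le_add (WW_natDegree _ _ _ _ _ _) hdd)
      · intro n
        rw [coeff_sub]
        refine (natDegree_sub_le _ _).trans (max_le ?_ ?_)
        · exact (WW_coeff_natDegree _ _ _ _ _ _ _).trans (by omega)
        · rw [coeff_mul]
          refine natDegree_sum_le_of_forall_le _ _ fun p _ => ?_
          exact natDegree_mul_le.trans (add_le_add (WW_coeff_natDegree _ _ _ _ _ _ _) (hdiv _))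
    ext l e
    rw [coeff_zero, coeff_zero]
    by_cases hl : l < D
    · by_cases he : e < E
      · have := congrFun (LinearMap.mem_ker.1 hv) (⟨j, hj⟩, ⟨l, hl⟩, ⟨e, he⟩)
        exact this
      · exact coeff_eq_zero_of_natDegree_lt (by have := hdeg l; omega)
    · have : (G (ext4 A B D v) j %ₘ P).natDegree < P.natDegree :=
        natDegree_modByMonic_lt _ hm (by rintro rfl; simp at hD; omega)
      have h2 : (G (ext4 A B D v) j %ₘ P).coeff l = 0 :=
        coeff_eq_zero_of_natDegree_lt (by omega)
      rw [h2, coeff_zero]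

end KW

namespace KW
open Polynomial Finset

lemma AA_natDegree {K : Type*} [CommRing K] (Q A B D : ℕ) (a : ℕ → ℕ → ℕ → ℕ → K) :
    (AA Q A B D a).natDegree ≤ D + Q * D := by
  refine natDegree_sum_le_of_forall_le _ _ fun l hl => natDegree_sum_le_of_forall_le _ _
    fun m _ => natDegree_sum_le_of_forall_le _ _ fun j hj => natDegree_sum_le_of_forall_le _ _
    fun i _ => (natDegree_C_mul_X_pow_le _ _).trans
      (add_le_add (Finset.mem_range.1 hl).le (Nat.mul_le_mul_left _ (Finset.mem_range.1 hj).le))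

lemma AA_coeff_natDegree {K : Type*} [CommRing K] (Q A B D : ℕ) (a : ℕ → ℕ → ℕ → ℕ → K) (n : ℕ) :
    ((AA Q A B D a).coeff n).natDegree ≤ B + Q * A := by
  simp only [AA, finsetSum_coeff, coeff_C_mul, coeff_X_pow, mul_ite, mul_one, mul_zero]
  refine natDegree_sum_le_of_forall_le _ _ fun l hl => natDegree_sum_le_of_forall_le _ _
    fun m hm => natDegree_sum_le_of_forall_le _ _ fun j _ =>
    natDegree_sum_le_of_forall_le _ _ fun i hi => ?_
  split_ifs
  · exact (natDegree_C_mul_X_pow_le _ _).trans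
      (add_le_add (Finset.mem_range.1 hm).le (Nat.mul_le_mul_left _ (Finset.mem_range.1 hi).le))
  · simp

lemma mem_range_of_pow_card {F k : Type*} [Field F] [Fintype F] [Field k] [Algebra F k] (y : k)
    (hy : y ^ Fintype.card F = y) : ∃ z : F, algebraMap F k z = y := by
  have h1 : ∏ z : F, (X - C z) = (X : F[X]) ^ Fintype.card F - X := by
    have hq1 : 1 < Fintype.card F := Fintype.one_lt_card
    have := prod_multiset_X_sub_C_of_monic_of_roots_card_eq
      (p := (X : F[X]) ^ Fintype.card F - X) (by
        apply monic_X_pow_sub; rw [degree_X]; exact_mod_cast hq1)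
      (by rw [FiniteField.roots_X_pow_card_sub_X, FiniteField.X_pow_card_sub_X_natDegree_eq F hq1]
          rfl)
    rw [FiniteField.roots_X_pow_card_sub_X] at this
    exact this
  have h2 := congrArg (aeval y) h1
  simp only [map_prod, map_sub, aeval_X, aeval_C, map_pow, hy, sub_self] at h2
  obtain ⟨z, -, hz⟩ := Finset.prod_eq_zero_iff.1 h2
  exact ⟨z, (sub_eq_zero.1 hz).symm⟩

lemma eval₂_spec {F k : Type*} [Field F] [Field k] [Algebra F k] (P : F[X][X]) (x : F) (y : k) :
    eval₂ (eval₂RingHom (algebraMap F k) (algebraMap F k x)) y P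
      = aeval y (P.map (evalRingHom x)) := by
  rw [aeval_def, eval₂_map]
  congr 1
  ext <;> simp

/-- Evaluation of the auxiliary polynomial at a conjugate pair. -/
lemma AA_vanish {F k : Type} [Field F] [Fintype F] [CharP F 2] [Field k] [CharP k 2] [Algebra F k]
    (P : F[X][X]) (D A B μ ν : ℕ)
    (hq : Fintype.card F = 2 ^ (μ + ν)) (hm : P.Monic) (hD : P.natDegree = D) (hD0 : 0 < D)
    (a' : ℕ → ℕ → ℕ → ℕ → F) (a : ℕ → ℕ → ℕ → ℕ → k)
    (haa : ∀ i j m l, a i j m l ^ (2 ^ μ) = algebraMap F k (a' i j m l))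
    (hW : ∀ j < D - 1, P ∣ WW (2 ^ μ) A B D a' j - WW (2 ^ μ) A B D a' (D - 1) * divX^[j + 1] P)
    (x : F) (y : k) (hy : aeval y (P.map (evalRingHom x)) = 0)
    (hne : y ^ Fintype.card F ≠ y) :
    eval₂ (eval₂RingHom (RingHom.id k) (algebraMap F k x)) y (AA (2 ^ ν) A B D a) = 0 := by
  set ev : F[X][X] →+* k := eval₂RingHom (eval₂RingHom (algebraMap F k) (algebraMap F k x)) y
    with hev
  set z := y ^ Fintype.card F with hz
  have hevP : ev P = 0 := by rw [← hy, ← eval₂_spec]; rfl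
  have hWj : ∀ j < D, ev (WW (2 ^ μ) A B D a' j)
      = ev (WW (2 ^ μ) A B D a' (D - 1)) * ev (divX^[j + 1] P) := by
    intro j hj
    by_cases hj1 : j < D - 1
    · obtain ⟨w, hw⟩ := hW j hj1
      have := congrArg ev hw
      rw [map_sub, map_mul, map_mul, hevP, zero_mul] at this
      exact sub_eq_zero.1 this
    · have hj2 : j = D - 1 := by omega
      have h1 : divX^[j + 1] P = 1 := by
        ext1 n
        rw [divX_iter_coeff, coeff_one]
        split_ifs with h
        · subst h; rw [show 0 + (j + 1) = P.natDegree by omega]; exact hm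
        · exact coeff_eq_zero_of_natDegree_lt (by omega)
      rw [h1, map_one, mul_one, hj2]
  -- the conjugate is a root
  set p0 : k[X] := (P.map (evalRingHom x)).map (algebraMap F k) with hp0
  have hp0m : p0.Monic := (hm.map _).map _
  have hp0d : p0.natDegree = D := by
    rw [hp0, (hm.map _).natDegree_map, hm.natDegree_map, hD]
  have hy0 : p0.eval y = 0 := by rw [hp0, eval_map_algebraMap]; exact hy
  have hz0 : p0.eval z = 0 := by
    rw [hp0, eval_map_algebraMap, hz]
    have h1 : (P.map (evalRingHom x)) ∣ (P.map (evalRingHom x)) := dvd_rfl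
    have h2 := FiniteField.expand_card (P.map (evalRingHom x))
    have h3 := congrArg (aeval y) h2
    rw [expand_aeval, map_pow, hy] at h3
    rw [h3, zero_pow Fintype.card_ne_zero]
  have hH : ∑ j ∈ range D, ev (divX^[j + 1] P) * z ^ j = 0 := by
    have h1 := horner p0 hp0m y z
    rw [hy0, hz0, sub_self, hp0d] at h1
    have h2 := (mul_eq_zero.1 h1).resolve_left (sub_ne_zero.2 hne)
    rw [← h2]
    refine Finset.sum_congr rfl fun j _ => ?_
    congr 1
    have h3 : divX^[j + 1] p0 = ((divX^[j + 1] P).map (evalRingHom x)).map (algebraMap F k) := by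
      ext n
      rw [divX_iter_coeff, hp0]
      simp only [coeff_map, divX_iter_coeff]
    rw [h3, eval_map_algebraMap, ← eval₂_spec]; rfl
  have hsum : ∑ j ∈ range D, ev (WW (2 ^ μ) A B D a' j) * z ^ j = 0 := by
    rw [Finset.sum_congr rfl fun j hj => by rw [hWj j (Finset.mem_range.1 hj), mul_assoc],
      ← Finset.mul_sum, hH, mul_zero]
  have hpow : (eval₂ (eval₂RingHom (RingHom.id k) (algebraMap F k x)) y (AA (2 ^ ν) A B D a))
      ^ (2 ^ μ) = 0 := by
    rw [← hsum, AA_eval₂]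
    have hxq : ∀ n, algebraMap F k x ^ (2 ^ μ * (2 ^ ν * n)) = algebraMap F k x ^ n := by
      intro n
      rw [← mul_assoc, ← pow_add, ← hq, pow_mul, ← map_pow, FiniteField.pow_card]
    simp only [sum_pow_char_pow]
    simp only [hev, coe_eval₂RingHom, WW_eval₂, Finset.sum_mul]
    conv_rhs => rw [Finset.sum_comm]
    refine Finset.sum_congr rfl fun l _ => ?_
    conv_rhs => rw [Finset.sum_comm]
    refine Finset.sum_congr rfl fun m _ => Finset.sum_congr rfl fun j _ =>
      Finset.sum_congr rfl fun i _ => ?_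
    rw [mul_pow, mul_pow, RingHom.id_apply, haa, ← pow_mul, add_mul, mul_comm (2 ^ ν * i), pow_add,
      hxq, hz, hq]
    ring
  exact pow_eq_zero_iff (by positivity) |>.1 hpow

lemma core {F : Type} [Field F] [Fintype F] [CharP F 2] (P : F[X][X]) (D c A B μ ν B0 E : ℕ)
    (hq : Fintype.card F = 2 ^ (μ + ν)) (hm : P.Monic) (hD : P.natDegree = D) (hD0 : 0 < D)
    (hC : ∀ l, (P.coeff l).natDegree ≤ c)
    (hirr : Irreducible (P.map (mapRingHom (algebraMap F (AlgebraicClosure F)))))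
    (hd : derivative P ≠ 0)
    (hE : E = 2 ^ μ * B + A + c + (2 ^ μ * D + D) * c + 1)
    (hdim : (D - 1) * D * E < A * D * B * D)
    (hν : 2 * D * (B + c) < 2 ^ ν)
    (hdeg : B + 2 ^ ν * A + (D + 2 ^ ν * D) * c + (B0 + 2 * D * (c + c)) < 2 ^ (μ + ν)) :
    B0 < {x : F | ∃ y, P.evalEval x y = 0}.ncard := by
  classical
  by_contra hle
  push Not at hle
  set k := AlgebraicClosure F
  have : CharP k 2 := charP_of_injective_algebraMap (algebraMap F k).injective 2
  have hirrF : Irreducible P := hm.irreducible_of_irreducible_map _ _ hirr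
  obtain ⟨ρ, hρ0, hρd, u, v, huv⟩ := norm_lemma P (derivative P) D c c hirrF hm hD hd
    (by rw [← hD]; exact natDegree_derivative_lt (by omega)) hC
    (by
      intro l
      rw [coeff_derivative]
      refine natDegree_mul_le.trans ?_
      have h1 : ((l : F[X]) + 1).natDegree = 0 := by exact_mod_cast natDegree_natCast (l + 1)
      rw [h1]; exact hC _)
  obtain ⟨a', ha0, hW⟩ := exists_arr P hm D c A B (2 ^ μ) E hD hD0 hC hE hdim
  let a : ℕ → ℕ → ℕ → ℕ → k := fun i j m l =>
    (iterateFrobeniusEquiv k 2 μ).symm (algebraMap F k (a' i j m l))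
  have haa : ∀ i j m l, a i j m l ^ (2 ^ μ) = algebraMap F k (a' i j m l) := by
    intro i j m l
    have := (iterateFrobeniusEquiv k 2 μ).apply_symm_apply (algebraMap F k (a' i j m l))
    rwa [iterateFrobeniusEquiv_apply, iterateFrobenius_def] at this
  set Pk : k[X][X] := P.map (mapRingHom (algebraMap F k)) with hPk
  have hmk : Pk.Monic := hm.map _
  have hDk : Pk.natDegree = D := by rw [hPk, hm.natDegree_map, hD]
  have hCk : ∀ l, (Pk.coeff l).natDegree ≤ c := by
    intro l; rw [hPk, coeff_map]; exact natDegree_map_le.trans (hC l)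
  have hdk : derivative Pk ≠ 0 := by
    rw [hPk, derivative_map, Ne, Polynomial.map_eq_zero_iff]
    · exact hd
    · exact map_injective _ (algebraMap F k).injective
  set r := AA (2 ^ ν) A B D a %ₘ Pk with hr
  have hPk1 : Pk ≠ 1 := by
    intro h; rw [h, natDegree_one] at hDk; omega
  have hrd : r.natDegree < D := hDk ▸ natDegree_modByMonic_lt _ hmk hPk1
  have hgood : ∀ x : F, (¬ ∃ y, P.evalEval x y = 0) → ρ.eval x ≠ 0 →
      ∀ l, (r.coeff l).eval (algebraMap F k x) = 0 := by
    intro x hx hρx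
    set p0 : F[X] := P.map (evalRingHom x) with hp0
    have hsep : p0.Separable := by
      refine ⟨C (ρ.eval x)⁻¹ * v.map (evalRingHom x), C (ρ.eval x)⁻¹ * u.map (evalRingHom x), ?_⟩
      have h1 := congrArg (Polynomial.map (evalRingHom x)) huv
      rw [Polynomial.map_add, Polynomial.map_mul, Polynomial.map_mul, map_C, ← derivative_map,
        ← hp0, coe_evalRingHom] at h1
      rw [mul_assoc, mul_assoc, ← mul_add, add_comm, mul_comm _ (derivative p0), mul_comm _ p0, h1,
        ← C_mul, inv_mul_cancel₀ hρx, C_1]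
    have hcard : Fintype.card (p0.rootSet k) = D := by
      rw [card_rootSet_eq_natDegree hsep (IsAlgClosed.splits _), hp0, hm.natDegree_map, hD]
    set rx : k[X] := r.map (evalRingHom (algebraMap F k x)) with hrx
    have hrx0 : rx = 0 := by
      refine eq_zero_of_natDegree_lt_card_of_eval_eq_zero' rx (p0.rootSet k).toFinset ?_ ?_
      · intro y hy
        rw [Set.mem_toFinset, mem_rootSet] at hy
        have hy2 := hy.2
        have hne : y ^ Fintype.card F ≠ y := by
          intro h
          obtain ⟨z, rfl⟩ := mem_range_of_pow_card y h
          apply hx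
          refine ⟨z, ?_⟩
          rw [aeval_algebraMap_apply, map_eq_zero_iff _ (algebraMap F k).injective] at hy2
          rw [← map_evalRingHom_eval, ← coe_aeval_eq_eval]; exact hy2
        have h1 := AA_vanish P D A B μ ν hq hm hD hD0 a' a haa hW x y hy2 hne
        set ev : k[X][X] →+* k := eval₂RingHom (eval₂RingHom (RingHom.id k) (algebraMap F k x)) y
        have hevP : ev Pk = 0 := by
          change eval₂ (eval₂RingHom (RingHom.id k) (algebraMap F k x)) y Pk = 0
          rw [hPk, eval₂_eval₂_map, RingHom.id_comp, eval₂_spec, hy2]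
        have h2 : ev r = 0 := by
          have h3 := modByMonic_add_div (AA (2 ^ ν) A B D a) Pk
          have h4 := congrArg ev h3
          rw [map_add, map_mul, hevP, zero_mul, add_zero] at h4
          rw [hr, h4]; exact h1
        rw [← h2, hrx, eval_map]
        rfl
      · rw [Set.toFinset_card, hcard]
        exact lt_of_le_of_lt natDegree_map_le hrd
    intro l
    have := congrArg (fun p => coeff p l) hrx0
    simpa [hrx] using this
  have hbound : ∀ l, (r.coeff l).natDegree ≤ B + 2 ^ ν * A + (D + 2 ^ ν * D) * c :=
    mod_deg Pk hmk (by omega) c hCk _ _ _ (AA_natDegree _ _ _ _ _) (AA_coeff_natDegree _ _ _ _ _)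
  have hr0 : r = 0 := by
    ext1 l
    rw [coeff_zero]
    set S := {x : F | ∃ y, P.evalEval x y = 0} with hS
    set G : Finset F := univ.filter (fun x => x ∉ S ∧ ρ.eval x ≠ 0) with hG
    refine eq_zero_of_natDegree_lt_card_of_eval_eq_zero' _ (G.image (algebraMap F k)) ?_ ?_
    · intro z hz
      obtain ⟨x, hx, rfl⟩ := Finset.mem_image.1 hz
      rw [hG, Finset.mem_filter] at hx
      exact hgood x hx.2.1 hx.2.2 l
    · rw [Finset.card_image_of_injective _ (algebraMap F k).injective]
      have h1 : (univ : Finset F) ⊆ G ∪ (S.toFinset ∪ ρ.roots.toFinset) := by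
        intro x _
        simp only [hG, Finset.mem_union, Finset.mem_filter, Finset.mem_univ, true_and,
          Set.mem_toFinset, Multiset.mem_toFinset, mem_roots hρ0, IsRoot.def]
        tauto
      have h2 := (Finset.card_le_card h1).trans ((Finset.card_union_le _ _).trans
        (Nat.add_le_add_left (Finset.card_union_le _ _) _))
      rw [Finset.card_univ, hq] at h2
      have h3 : S.toFinset.card ≤ B0 := by
        rw [← Set.ncard_eq_toFinset_card']; exact hle
      have h4 : ρ.roots.toFinset.card ≤ 2 * D * (c + c) :=
        (Multiset.toFinset_card_le _).trans ((card_roots' _).trans hρd)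
      have := hbound l
      omega
  have hdvd : Pk ∣ AA (2 ^ ν) A B D a := (modByMonic_eq_zero_iff_dvd hmk).1 hr0
  have hz := indep Pk D c A B ν hirr hmk hdk hDk hCk hν a hdvd
  obtain ⟨i, hi, j, hj, m, hm', l, hl, h⟩ := ha0
  apply h
  have h1 := haa i j m l
  rw [hz i hi j hj m hm' l hl, zero_pow (by positivity)] at h1
  exact (map_eq_zero_iff _ (algebraMap F k).injective).1 h1.symm

lemma arith1 (D' A B M K Z : ℕ) (hA : M = A + K) (hμ : 2 * K * (D' + 1) < M) (hK : 1 ≤ K)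
    (hB : B = 2 * (D' + 1) * Z) (hZ : 0 < Z) : D' * (M * B + Z) < A * B * (D' + 1) := by
  have hB0 : 0 < B := by rw [hB]; positivity
  have h1 : D' * Z * 2 ≤ B := by
    rw [hB]
    calc D' * Z * 2 = 2 * D' * Z := by ring
      _ ≤ 2 * (D' + 1) * Z := Nat.mul_le_mul_right _ (by omega)
  have h2 : 2 * K * (D' + 1) * B < M * B := Nat.mul_lt_mul_of_pos_right hμ hB0
  have h3 : A * B * (D' + 1) + K * (D' + 1) * B = M * B * (D' + 1) := by rw [hA]; ring
  have h4 : 1 * B ≤ K * (D' + 1) * B := Nat.mul_le_mul_right _ (Nat.mul_pos hK (by omega))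
  have h5 : D' * (M * B + Z) + M * B = M * B * (D' + 1) + D' * Z := by ring
  have h6 : 2 * K * (D' + 1) * B = 2 * (K * (D' + 1) * B) := by ring
  omega

/-- Lower bound for the number of points (Stepanov's method), for one degree. -/
lemma stepanov_one (D c B0 : ℕ) (hD0 : 0 < D) : ∃ q0 : ℕ, ∀ (F : Type) [Field F] [Fintype F] [CharP F 2],
    q0 ≤ Fintype.card F → ∀ P : F[X][X], P.Monic → P.natDegree = D →
    (∀ l, (P.coeff l).natDegree ≤ c) →
    Irreducible (P.map (mapRingHom (algebraMap F (AlgebraicClosure F)))) →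
    derivative P ≠ 0 → B0 < {x : F | ∃ y, P.evalEval x y = 0}.ncard := by
  set K := D * c + 1 with hK
  obtain ⟨μ, hμ⟩ : ∃ μ : ℕ, 2 * K * D < 2 ^ μ := ⟨_, Nat.lt_two_pow_self⟩
  set M := 2 ^ μ with hM
  set A := M - K with hA
  set B := 2 * D * (M + c + (M * D + D) * c + 1) with hB
  have hKM : K ≤ M := by nlinarith
  refine ⟨M * (B + D * c + B0 + 2 * D * (c + c) + 2 * D * (B + c) + 1), ?_⟩
  intro F _ _ _ hcard P hm hD hC hirr hd
  obtain ⟨N, hN⟩ : ∃ N : ℕ, Fintype.card F = 2 ^ N := by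
    obtain ⟨N, -, hN⟩ := FiniteField.card F 2
    exact ⟨N, hN⟩
  have hMN : M ≤ 2 ^ N := by
    rw [← hN]; refine le_trans ?_ hcard
    exact Nat.le_mul_of_pos_right _ (by positivity)
  have hμN : μ ≤ N := (Nat.pow_le_pow_iff_right (by norm_num)).1 hMN
  obtain ⟨ν, rfl⟩ := Nat.exists_eq_add_of_le hμN
  rw [hN, pow_add] at hcard
  have hQ : B + D * c + B0 + 2 * D * (c + c) + 2 * D * (B + c) + 1 ≤ 2 ^ ν :=
    Nat.le_of_mul_le_mul_left hcard (by positivity)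
  refine core P D c A B μ ν B0 _ hN hm hD hD0 hC hirr hd rfl ?_ ?_ ?_
  · rw [← hM]
    obtain ⟨D', rfl⟩ : ∃ D', D = D' + 1 := ⟨D - 1, by omega⟩
    have hAK : M = A + K := by omega
    rw [Nat.add_sub_cancel]
    have h1 : D' * (M * B + A + c + (M * (D' + 1) + (D' + 1)) * c + 1) < A * B * (D' + 1) := by
      set Z := M + c + (M * (D' + 1) + (D' + 1)) * c + 1 with hZ
      have h2 : D' * (M * B + A + c + (M * (D' + 1) + (D' + 1)) * c + 1) ≤ D' * (M * B + Z) := by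
        apply Nat.mul_le_mul_left; omega
      refine lt_of_le_of_lt h2 ?_
      exact arith1 D' A B M K Z hAK hμ (by omega) hB (by omega)
    calc D' * (D' + 1) * (M * B + A + c + (M * (D' + 1) + (D' + 1)) * c + 1)
        = (D' * (M * B + A + c + (M * (D' + 1) + (D' + 1)) * c + 1)) * (D' + 1) := by ring
      _ < (A * B * (D' + 1)) * (D' + 1) := Nat.mul_lt_mul_of_pos_right h1 (by omega)
      _ = _ := by ring
  · omega
  · have hAK : A + K = M := by omega
    rw [pow_add, ← hM, ← hAK, hK]
    have : B + D * c + (B0 + 2 * D * (c + c)) < 2 ^ ν := by omega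
    nlinarith

lemma stepanov (Dm c B0 : ℕ) : ∃ q0 : ℕ, ∀ (F : Type) [Field F] [Fintype F] [CharP F 2],
    q0 ≤ Fintype.card F → ∀ P : F[X][X], P.Monic → P.natDegree ≤ Dm →
    (∀ l, (P.coeff l).natDegree ≤ c) →
    Irreducible (P.map (mapRingHom (algebraMap F (AlgebraicClosure F)))) →
    derivative P ≠ 0 → B0 < {x : F | ∃ y, P.evalEval x y = 0}.ncard := by
  have h := fun D : ℕ => stepanov_one (D + 1) c B0 (Nat.succ_pos D)
  choose q hq using h
  refine ⟨∑ D ∈ range (Dm + 1), q D, ?_⟩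
  intro F _ _ _ hcard P hm hD hC hirr hd
  have hD0 : 0 < P.natDegree := by
    by_contra h0
    exact hd (by rw [eq_C_of_natDegree_eq_zero (by omega : P.natDegree = 0), derivative_C])
  refine hq (P.natDegree - 1) F (le_trans ?_ hcard) P hm (by omega) hC hirr hd
  exact Finset.single_le_sum (f := q) (fun _ _ => Nat.zero_le _) (Finset.mem_range.2 (by omega))

end KW

namespace KW
open Polynomial Finset

lemma coeff_coeff_swap {K : Type*} [CommRing K] (p : K[X][X]) (i j : ℕ) :
    ((Bivariate.swap p).coeff i).coeff j = (p.coeff j).coeff i := by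
  induction p using Polynomial.induction_on' with
  | add p q hp hq => simp [hp, hq]
  | monomial n f =>
    induction f using Polynomial.induction_on' with
    | add p q hp hq => rw [(monomial n).map_add, map_add]; simp [hp, hq]
    | monomial m r =>
      rw [Bivariate.swap_monomial_monomial]
      simp only [coeff_monomial]
      split_ifs <;> simp_all [coeff_monomial]

lemma coeff_natDegree_iff {K : Type*} [CommRing K] (p : K[X][X]) (c : ℕ) :
    (∀ l, (p.coeff l).natDegree ≤ c) ↔ (Bivariate.swap p).natDegree ≤ c := by
  simp only [natDegree_le_iff_coeff_eq_zero]
  constructor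
  · intro h N hN
    ext j
    rw [coeff_coeff_swap, h j N hN, coeff_zero]
  · intro h l N hN
    rw [← coeff_coeff_swap, h N hN, coeff_zero]

lemma coeff_natDegree_of_dvd {K : Type*} [Field K] (p r : K[X][X]) (c : ℕ) (hp : p ≠ 0)
    (h : r ∣ p) (hc : ∀ l, (p.coeff l).natDegree ≤ c) : ∀ l, (r.coeff l).natDegree ≤ c := by
  rw [coeff_natDegree_iff] at hc ⊢
  obtain ⟨w, rfl⟩ := h
  rw [map_mul] at hc
  have h1 : Bivariate.swap r * Bivariate.swap w ≠ 0 := by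
    rw [← map_mul]
    simpa using hp
  rw [natDegree_mul (left_ne_zero_of_mul h1) (right_ne_zero_of_mul h1)] at hc
  omega

lemma exists_monic_factor {K : Type*} [Field K] (P : K[X][X]) (hm : P.Monic) {S : Type*} [Field S]
    (ev : K[X][X] →+* S) (h : ev P = 0) : ∃ R, R.Monic ∧ Irreducible R ∧ R ∣ P ∧ ev R = 0 := by
  have h1 := UniqueFactorizationMonoid.factors_prod hm.ne_zero
  have h2 : ev (UniqueFactorizationMonoid.factors P).prod = 0 := by
    obtain ⟨u, hu⟩ := h1
    have := congrArg ev hu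
    rw [map_mul, h] at this
    exact (mul_eq_zero.1 this).resolve_right (u.isUnit.map ev).ne_zero
  rw [map_multiset_prod, Multiset.prod_eq_zero_iff, Multiset.mem_map] at h2
  obtain ⟨g, hg, hg0⟩ := h2
  have hirr := UniqueFactorizationMonoid.irreducible_of_factor g hg
  obtain ⟨w, hw⟩ := UniqueFactorizationMonoid.dvd_of_mem_factors hg
  have hl : w.leadingCoeff * g.leadingCoeff = 1 := by
    rw [mul_comm, ← leadingCoeff_mul, ← hw]; exact hm
  have hu : IsUnit (C w.leadingCoeff) := isUnit_C.2 (IsUnit.of_mul_eq_one _ hl)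
  refine ⟨C w.leadingCoeff * g, ?_, ?_, ?_, ?_⟩
  · rw [Monic, leadingCoeff_mul, leadingCoeff_C, hl]
  · exact (irreducible_isUnit_mul hu).2 hirr
  · rw [hu.mul_left_dvd]; exact ⟨w, hw⟩
  · rw [map_mul, hg0, mul_zero]

lemma smooth_factor {F : Type} [Field F] [Fintype F] (P : F[X][X]) (hm : P.Monic) (y0 s0 : F)
    (h0 : P.evalEval y0 s0 = 0) (h1 : (derivative P).evalEval y0 s0 ≠ 0) (c : ℕ)
    (hC : ∀ l, (P.coeff l).natDegree ≤ c) :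
    ∃ R : F[X][X], R.Monic ∧ R ∣ P ∧
      Irreducible (R.map (mapRingHom (algebraMap F (AlgebraicClosure F)))) ∧
      R.evalEval y0 s0 = 0 ∧ derivative R ≠ 0 ∧ ∀ l, (R.coeff l).natDegree ≤ c := by
  set k := AlgebraicClosure F
  let i : F →+* k := algebraMap F k
  have hi : Function.Injective i := i.injective
  have hI : Function.Injective (mapRingHom i) := map_injective _ hi
  set Pk := P.map (mapRingHom i) with hPk
  have hmk : Pk.Monic := hm.map _
  let ev : k[X][X] →+* k := evalEvalRingHom (i y0) (i s0)
  have hev : ∀ R : F[X][X], ev (R.map (mapRingHom i)) = i (R.evalEval y0 s0) := fun R =>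
    map_mapRingHom_evalEval i R y0 s0
  obtain ⟨R', hR'm, hR'i, hR'd, hR'0⟩ := exists_monic_factor Pk hmk ev (by
    rw [hPk, hev, h0, map_zero])
  let σ : k →+* k := (FiniteField.frobeniusAlgHom F k : k →ₐ[F] k)
  have hσ : ∀ a, σ a = a ^ Fintype.card F := fun a => rfl
  have hσi : ∀ a, σ (i a) = i a := fun a => (FiniteField.frobeniusAlgHom F k).commutes a
  set Rs := R'.map (mapRingHom σ) with hRs
  have hRsm : Rs.Monic := hR'm.map _
  have hPs : Pk.map (mapRingHom σ) = Pk := by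
    ext l m
    simp [hPk, hσi]
  have hRsd : Rs ∣ Pk := by
    rw [← hPs]; exact Polynomial.map_dvd _ hR'd
  have hRs0 : ev Rs = 0 := by
    have h2 := map_mapRingHom_evalEval σ R' (i y0) (i s0)
    rw [hσi, hσi] at h2
    change evalEval (i y0) (i s0) Rs = 0
    rw [h2]
    change σ (ev R') = 0
    rw [hR'0, map_zero]
  have heq : Rs = R' := by
    by_cases hdv : R' ∣ Rs
    · exact (eq_of_monic_of_dvd_of_natDegree_le hR'm hRsm hdv
        (by rw [hRs, hR'm.natDegree_map])).symm ▸ rfl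
    · exfalso
      obtain ⟨V, hV⟩ := hRsd
      have hpr : Prime R' := hR'i.prime
      have h3 : R' ∣ Rs * V := hV ▸ hR'd
      obtain ⟨V', rfl⟩ := (hpr.dvd_or_dvd h3).resolve_left hdv
      have h4 : ev (derivative Pk) = 0 := by
        rw [hV]
        simp only [derivative_mul, map_add, map_mul, hRs0, hR'0]
        ring
      rw [hPk, derivative_map, hev] at h4
      exact h1 ((map_eq_zero_iff _ hi).1 h4)
  have hlift : R' ∈ lifts (mapRingHom i) := by
    rw [lifts_iff_coeffs_subset_range]
    rintro _ hx
    obtain ⟨l, -, rfl⟩ := mem_coeffs_iff.1 hx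
    have : R'.coeff l ∈ lifts i := by
      rw [lifts_iff_coeff_lifts]
      intro m
      have h5 : σ ((R'.coeff l).coeff m) = (R'.coeff l).coeff m := by
        conv_rhs => rw [← heq, hRs]
        simp
      rw [hσ] at h5
      obtain ⟨z, hz⟩ := mem_range_of_pow_card _ h5
      exact ⟨z, hz⟩
    rw [mem_lifts] at this
    obtain ⟨q, hq⟩ := this
    exact ⟨q, hq⟩
  rw [mem_lifts] at hlift
  obtain ⟨R, hR⟩ := hlift
  have hRm : R.Monic := monic_of_injective hI (by rw [hR]; exact hR'm)
  have hRd : R ∣ P := by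
    rw [← map_dvd_map _ hI hRm, hR]; exact hR'd
  have hR0 : R.evalEval y0 s0 = 0 := by
    rw [← map_eq_zero_iff i hi, ← hev, hR, hR'0]
  refine ⟨R, hRm, hRd, hR ▸ hR'i, hR0, ?_, coeff_natDegree_of_dvd P R c hm.ne_zero hRd hC⟩
  intro hd
  obtain ⟨W, rfl⟩ := hRd
  apply h1
  rw [derivative_mul, hd, zero_mul, zero_add, evalEval_mul, hR0, zero_mul]

end KW

namespace KW
open Polynomial Finset

/-- `M · (X² + X) = X^(2^k) + X` -/
noncomputable def MM (F : Type*) [CommRing F] (k : ℕ) : F[X] :=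
  ∑ i ∈ range k, (X ^ 2 + X) ^ (2 ^ i - 1)

lemma MM_mul {F : Type*} [CommRing F] [CharP F 2] (k : ℕ) :
    MM F k * (X ^ 2 + X) = X ^ (2 ^ k) + X := by
  induction k with
  | zero => simp [MM, CharTwo.add_self_eq_zero]
  | succ k ih =>
    have : MM F (k + 1) = MM F k + (X ^ 2 + X) ^ (2 ^ k - 1) := by
      simp [MM, Finset.sum_range_succ]
    rw [this, add_mul, ih, ← pow_succ, Nat.sub_add_cancel Nat.one_le_two_pow, add_pow_char_pow,
      ← pow_mul, ← pow_succ']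
    have h2 : (X : F[X]) ^ 2 ^ k + X ^ 2 ^ k = 0 := CharTwo.add_self_eq_zero _
    linear_combination h2

lemma MM_map {F G : Type*} [CommRing F] [CommRing G] (f : F →+* G) (k : ℕ) :
    (MM F k).map f = MM G k := by
  simp [MM, Polynomial.map_sum]

lemma XX_natDegree (F : Type*) [Field F] : ((X : F[X]) ^ 2 + X).natDegree = 2 := by
  compute_degree!

lemma MM_natDegree {F : Type*} [Field F] [CharP F 2] (k : ℕ) (hk : 2 ≤ k) :
    (MM F k).natDegree + 2 = 2 ^ k := by
  have hQ : 1 < 2 ^ k := Nat.one_lt_two_pow (by omega)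
  have hd : ((X : F[X]) ^ (2 ^ k) + X).natDegree = 2 ^ k := by
    rw [natDegree_add_eq_left_of_natDegree_lt] <;> simp [hQ]
  have h1 := MM_mul (F := F) k
  have hne : MM F k * (X ^ 2 + X) ≠ 0 := by
    rw [h1]; intro h; rw [h, natDegree_zero] at hd; omega
  have h3 := natDegree_mul (left_ne_zero_of_mul hne) (right_ne_zero_of_mul hne)
  rw [h1, hd, XX_natDegree F] at h3
  exact h3.symm

lemma C0_irred {K : Type*} [Field K] [IsAlgClosed K] [CharP K 2] (k m : ℕ) (hk : 2 ≤ k)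
    (hm : 0 < m) (b : K) (hb : b ≠ 0) :
    Irreducible ((X : K[X][X]) ^ m + C (C b * MM K k)) := by
  have hMd := MM_natDegree (F := K) k hk
  have h4 : 2 ^ 2 ≤ 2 ^ k := Nat.pow_le_pow_right (by norm_num) hk
  obtain ⟨α, hα⟩ := IsAlgClosed.exists_root (MM K k) (by
    intro h; have h0 := natDegree_eq_zero_iff_degree_le_zero.2 h.le; omega)
  have hmon : ((X : K[X][X]) ^ m + C (C b * MM K k)).Monic := monic_X_pow_add_C _ hm.ne'
  have hdeg : ((X : K[X][X]) ^ m + C (C b * MM K k)).degree = m := degree_X_pow_add_C hm _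
  have hp : Prime (X - C α) := prime_X_sub_C α
  refine irreducible_of_eisenstein_criterion (P := Ideal.span {X - C α})
    ((Ideal.span_singleton_prime hp.ne_zero).2 hp) ?_ ?_ ?_ ?_ hmon.isPrimitive
  · rw [hmon.leadingCoeff, Ideal.mem_span_singleton]
    exact fun h => hp.not_isUnit (isUnit_of_dvd_one h)
  · intro n hn
    rw [hdeg] at hn
    have hn' : n < m := by exact_mod_cast hn
    rw [coeff_add, coeff_X_pow, if_neg hn'.ne, zero_add, coeff_C]
    split_ifs
    · rw [Ideal.mem_span_singleton]
      exact (dvd_iff_isRoot.2 hα).mul_left _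
    · exact zero_mem _
  · rw [hdeg]; exact_mod_cast hm
  · rw [coeff_add, coeff_X_pow, if_neg hm.ne, zero_add, coeff_C_zero, Ideal.span_singleton_pow,
      Ideal.mem_span_singleton, (isUnit_C.2 hb.isUnit).dvd_mul_left]
    rintro ⟨w, hw⟩
    have h1 := congrArg derivative (MM_mul (F := K) k)
    have h2 := congrArg (eval α) h1
    rw [hw] at h2
    have hQ : ((2 ^ k : ℕ) : K) = 0 := by
      rw [Nat.cast_pow, Nat.cast_ofNat, CharTwo.two_eq_zero, zero_pow (by omega)]
    simp [derivative_mul, derivative_pow, hQ] at h2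

lemma point_C0 (k m : ℕ) (hk : 2 ≤ k) (hm : m % 2 = 1) : ∃ q0 : ℕ,
    ∀ (F : Type) [Field F] [Fintype F] [CharP F 2], q0 ≤ Fintype.card F → ∀ a : F, a ≠ 0 →
    ∃ x0 y0 : F, a * y0 ^ (2 * m) * (x0 ^ 2 + x0) = x0 ^ (2 ^ k) + x0 ∧ a * y0 ^ (2 * m) ≠ 1 ∧
      x0 ^ 2 + x0 ≠ 0 := by
  classical
  obtain ⟨q0, hq0⟩ := stepanov m (2 ^ k) (2 ^ k)
  refine ⟨q0, ?_⟩
  intro F _ _ _ hcard a ha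
  have hm0 : 0 < m := by omega
  have hMd := MM_natDegree (F := F) k hk
  have h4 : 2 ^ 2 ≤ 2 ^ k := Nat.pow_le_pow_right (by norm_num) hk
  set P : F[X][X] := X ^ m + C (C a⁻¹ * MM F k) with hP
  have : CharP (AlgebraicClosure F) 2 :=
    charP_of_injective_algebraMap (algebraMap F (AlgebraicClosure F)).injective 2
  have h := hq0 F hcard P (monic_X_pow_add_C _ hm0.ne') (by rw [hP, natDegree_X_pow_add_C]) ?_ ?_ ?_
  · set N : F[X] := X ^ (2 ^ k) + X ^ 2 with hN
    have hNd : N.natDegree = 2 ^ k := by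
      rw [hN, natDegree_add_eq_left_of_natDegree_lt] <;> simp
      omega
    have hN0 : N ≠ 0 := by intro h0; rw [h0, natDegree_zero] at hNd; omega
    obtain ⟨x0, ⟨Y0, hY⟩, hx0⟩ : ∃ x0 ∈ {x : F | ∃ y, P.evalEval x y = 0}, x0 ∉ N.roots.toFinset := by
      by_contra hcon
      push Not at hcon
      have h1 := Set.ncard_le_ncard (s := {x : F | ∃ y, P.evalEval x y = 0})
        (t := (N.roots.toFinset : Set F)) (fun x hx => by exact_mod_cast hcon x hx)
      rw [Set.ncard_coe_finset] at h1
      have h2 := (Multiset.toFinset_card_le N.roots).trans (card_roots' N)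
      omega
    rw [Multiset.mem_toFinset, mem_roots hN0, IsRoot.def] at hx0
    have hx1 : x0 ^ (2 ^ k) ≠ x0 ^ 2 := by
      intro h1; apply hx0; simp [hN, h1, CharTwo.add_self_eq_zero]
    obtain ⟨y0, hy0⟩ := FiniteField.isSquare_of_char_two (ringChar.eq F 2 ▸ rfl : ringChar F = 2) Y0
    have hYm : Y0 ^ m = a⁻¹ * (MM F k).eval x0 := by
      have : Y0 ^ m + a⁻¹ * (MM F k).eval x0 = 0 := by
        rw [← hY, hP]; simp [evalEval]
      rw [eq_neg_of_add_eq_zero_left this, CharTwo.neg_eq]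
    have hM := congrArg (eval x0) (MM_mul (F := F) k)
    simp only [eval_mul, eval_add, eval_pow, eval_X] at hM
    have hmain : a * y0 ^ (2 * m) * (x0 ^ 2 + x0) = x0 ^ (2 ^ k) + x0 := by
      rw [pow_mul, sq, ← hy0, hYm, ← hM, mul_inv_cancel_left₀ ha]
    refine ⟨x0, y0, hmain, ?_, ?_⟩
    · intro h1
      rw [h1, one_mul] at hmain
      exact hx1 (add_right_cancel hmain).symm
    · intro h1
      rw [h1, mul_zero] at hmain
      exact hx1 (add_right_cancel (hmain.symm.trans h1.symm))
  · intro l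
    rw [hP, coeff_add, coeff_X_pow, coeff_C]
    refine (natDegree_add_le _ _).trans (max_le ?_ ?_)
    · split_ifs <;> simp
    · split_ifs
      · exact (natDegree_C_mul_le _ _).trans (by omega)
      · simp
  · have := C0_irred (K := AlgebraicClosure F) k m hk hm0 (algebraMap F _ a⁻¹) (by simpa using ha)
    rw [hP]
    simpa [MM_map] using this
  · rw [hP, derivative_add, derivative_C, add_zero, derivative_X_pow]
    have : ((m : ℕ) : F[X]) = 1 := by
      rw [CharTwo.natCast_eq_mod, hm, Nat.cast_one]
    simp [this]
end KW

namespace KW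
open Polynomial Finset

lemma binom3 {R : Type*} [CommRing R] (w : R) (j : ℕ) :
    ∃ g : R, (1 + w) ^ j = 1 + j * w + (j.choose 2 : ℕ) * w ^ 2 + (j.choose 3 : ℕ) * w ^ 3
      + w ^ 4 * g := by
  induction j with
  | zero => exact ⟨0, by simp⟩
  | succ j ih =>
    obtain ⟨g, hg⟩ := ih
    refine ⟨(j.choose 3 : ℕ) + (1 + w) * g, ?_⟩
    rw [pow_succ, hg, Nat.choose_succ_succ j 1, Nat.choose_succ_succ j 2]
    push_cast
    simp only [Nat.choose_one_right]
    ring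

lemma T_small {R : Type*} [CommRing R] [CharP R 2] (v x : R) (j : ℕ) :
    ∃ G, 1 + (1 + v * x) ^ j + (1 + v) ^ j + (1 + v * x + v) ^ j
      = v ^ 3 * ((j.choose 3 : ℕ) * (x ^ 2 + x) + v * G) := by
  obtain ⟨g1, h1⟩ := binom3 (v * x) j
  obtain ⟨g2, h2⟩ := binom3 v j
  obtain ⟨g3, h3⟩ := binom3 (v * x + v) j
  refine ⟨x ^ 4 * g1 + g2 + (x + 1) ^ 4 * g3, ?_⟩
  rw [add_assoc 1 (v * x) v, h1, h2, h3]
  have h2' : (2 : R) = 0 := CharTwo.two_eq_zero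
  linear_combination (2 + j * (v * x + v) + (j.choose 2 : ℕ) * v ^ 2 * (x ^ 2 + x + 1)
    + (j.choose 3 : ℕ) * v ^ 3 * (x ^ 3 + x ^ 2 + x + 1)) * h2'

lemma kasami_expand {R : Type*} [CommRing R] [CharP R 2] (v z : R) (k : ℕ) (hk : 2 ≤ k) :
    ∃ g, (1 + v * z) ^ (2 ^ k * (2 ^ k - 1) + 1)
      = 1 + v * z + v ^ 2 ^ k * z ^ 2 ^ k + v ^ (2 ^ k + 1) * (z ^ 2 ^ k * z)
        + v ^ (2 ^ k + 2) * g := by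
  have h4 : 2 ^ 2 ≤ 2 ^ k := Nat.pow_le_pow_right (by norm_num) hk
  set Q := 2 ^ k with hQ
  obtain ⟨g, hg⟩ := binom3 ((v * z) ^ Q) (Q - 1)
  have hodd : ((Q - 1 : ℕ) : R) = 1 := by
    have h2 : (Q - 1) % 2 = 1 := by
      have : 2 ∣ Q := dvd_pow_self 2 (by omega)
      omega
    rw [CharTwo.natCast_eq_mod, h2, Nat.cast_one]
  obtain ⟨n, hn⟩ : ∃ n, Q = n + 2 := ⟨Q - 2, by omega⟩
  have hvQ : (v ^ Q) ^ 2 = v ^ (Q + 2) * v ^ n := by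
    rw [← pow_mul, ← pow_add]; congr 1; omega
  have h1Q : (1 + v * z) ^ Q = 1 + (v * z) ^ Q := by
    rw [hQ, add_pow_char_pow, one_pow]
  rw [pow_succ, pow_mul, h1Q, hg, hodd]
  refine ⟨v ^ n * (z ^ Q) ^ 2 * (((Q - 1).choose 2 : ℕ) + ((Q - 1).choose 3 : ℕ) * (v * z) ^ Q
    + ((v * z) ^ Q) ^ 2 * g) * (1 + v * z), ?_⟩
  rw [mul_pow v z Q, pow_succ v Q]
  linear_combination ((z ^ Q) ^ 2 * (((Q - 1).choose 2 : ℕ) + ((Q - 1).choose 3 : ℕ) * (v ^ Q * z ^ Q)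
    + (v ^ Q * z ^ Q) ^ 2 * g) * (1 + v * z)) * hvQ

lemma T_big {R : Type*} [CommRing R] [CharP R 2] (v x : R) (k : ℕ) (hk : 2 ≤ k) :
    ∃ G, 1 + (1 + v * x) ^ (2 ^ k * (2 ^ k - 1) + 1) + (1 + v) ^ (2 ^ k * (2 ^ k - 1) + 1)
      + (1 + v * x + v) ^ (2 ^ k * (2 ^ k - 1) + 1)
      = v ^ (2 ^ k + 1) * (x ^ 2 ^ k + x + v * G) := by
  obtain ⟨g1, h1⟩ := kasami_expand v x k hk
  obtain ⟨g2, h2⟩ := kasami_expand v 1 k hk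
  obtain ⟨g3, h3⟩ := kasami_expand v (x + 1) k hk
  rw [mul_one] at h2
  rw [show 1 + v * x + v = 1 + v * (x + 1) by ring, h1, h2, h3, add_pow_char_pow]
  refine ⟨g1 + g2 + g3, ?_⟩
  have h2' : (2 : R) = 0 := CharTwo.two_eq_zero
  simp only [one_pow]
  linear_combination (2 + v * x + v + v ^ 2 ^ k * (x ^ 2 ^ k + 1)
    + v ^ (2 ^ k + 1) * (x ^ 2 ^ k * x + 1)) * h2'

section deg
variable {F : Type*} [Field F] [CharP F 2]

/-- the four-term sum -/
noncomputable def TT (x : F[X]) (e j : ℕ) : F[X] :=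
  1 + (1 + X ^ e * x) ^ j + (1 + X ^ e) ^ j + (1 + X ^ e * x + X ^ e) ^ j

lemma TT_eq (x : F[X]) (e j : ℕ) : TT x e j = (1 + (1 + X ^ e) ^ j)
    + (∑ i ∈ range j, (1 + X ^ e * x + X ^ e) ^ i * (1 + X ^ e * x) ^ (j - 1 - i)) * X ^ e := by
  have h := geom_sum₂_mul (1 + X ^ e * x + X ^ e) (1 + X ^ e * x) j
  rw [add_sub_cancel_left] at h
  rw [h, TT]
  have h2' : (2 : F[X]) = 0 := CharTwo.two_eq_zero
  linear_combination (1 + X ^ e * x) ^ j * h2'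

lemma TT_zero (x : F[X]) (e : ℕ) : TT x e 0 = 0 := by
  have h2' : (2 : F[X]) = 0 := CharTwo.two_eq_zero
  simp only [TT, pow_zero]
  linear_combination 2 * h2'

lemma monic_one_add (x : F[X]) (hx : x.Monic) (r e : ℕ) (hr : 1 ≤ r) (hxd : x.natDegree = r) :
    (1 + X ^ e * x).Monic ∧ (1 + X ^ e * x).natDegree = e + r ∧
    (1 + X ^ e * x + X ^ e).Monic ∧ (1 + X ^ e * x + X ^ e).natDegree = e + r := by
  have hm : (X ^ e * x).Monic := (monic_X_pow e).mul hx
  have hd : (X ^ e * x).natDegree = e + r := by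
    rw [(monic_X_pow e).natDegree_mul hx, natDegree_X_pow, hxd]
  have hdeg : (X ^ e * x).degree = ((e + r : ℕ) : WithBot ℕ) := by
    rw [degree_eq_natDegree hm.ne_zero, hd]
  have h1 : (1 : F[X]).degree < (X ^ e * x).degree := by
    rw [hdeg, degree_one]; exact_mod_cast (by omega : 0 < e + r)
  have hm1 : (1 + X ^ e * x).Monic := hm.add_of_right h1
  have hd1 : (1 + X ^ e * x).degree = ((e + r : ℕ) : WithBot ℕ) := by
    rw [degree_add_eq_right_of_degree_lt h1, hdeg]
  have h2 : ((X : F[X]) ^ e).degree < (1 + X ^ e * x).degree := by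
    rw [hd1, degree_X_pow]; exact_mod_cast (by omega : e < e + r)
  refine ⟨hm1, natDegree_eq_of_degree_eq_some hd1, hm1.add_of_left h2, ?_⟩
  apply natDegree_eq_of_degree_eq_some
  rw [degree_add_eq_left_of_degree_lt h2, hd1]

lemma V_deg (e j : ℕ) : (1 + (1 + (X : F[X]) ^ e) ^ j).natDegree ≤ e * j := by
  have h1 : (1 + (X : F[X]) ^ e).natDegree ≤ e := by
    refine (natDegree_add_le _ _).trans (max_le (by simp) (by simp))
  refine (natDegree_add_le _ _).trans (max_le (by simp) ?_)
  refine natDegree_pow_le.trans ?_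
  rw [mul_comm]; exact Nat.mul_le_mul_right _ h1

lemma term_facts (x : F[X]) (hx : x.Monic) (r e j i : ℕ) (hr : 1 ≤ r) (hxd : x.natDegree = r)
    (hi : i ≤ j) :
    ((1 + X ^ e * x + X ^ e) ^ i * (1 + X ^ e * x) ^ (j - i)).Monic ∧
    ((1 + X ^ e * x + X ^ e) ^ i * (1 + X ^ e * x) ^ (j - i)).natDegree = (e + r) * j := by
  obtain ⟨hm1, hd1, hm2, hd2⟩ := monic_one_add x hx r e hr hxd
  refine ⟨(hm2.pow i).mul (hm1.pow _), ?_⟩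
  rw [(hm2.pow i).natDegree_mul (hm1.pow _), hm2.natDegree_pow, hm1.natDegree_pow, hd1, hd2,
    ← add_mul, Nat.add_sub_cancel' hi, mul_comm]

lemma TT_deg (x : F[X]) (hx : x.Monic) (r e j : ℕ) (hr : 1 ≤ r) (hxd : x.natDegree = r) :
    (TT x e (j + 1)).natDegree ≤ e * (j + 1) + r * j := by
  rw [TT_eq]
  refine (natDegree_add_le _ _).trans (max_le ((V_deg _ _).trans (Nat.le_add_right _ _)) ?_)
  refine natDegree_mul_le.trans ?_
  rw [natDegree_X_pow]
  have : (∑ i ∈ range (j + 1), (1 + X ^ e * x + X ^ e) ^ i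
      * (1 + X ^ e * x) ^ (j + 1 - 1 - i)).natDegree ≤ (e + r) * j := by
    refine natDegree_sum_le_of_forall_le _ _ fun i hi => ?_
    rw [Nat.add_sub_cancel]
    exact (term_facts x hx r e j i hr hxd (by have := Finset.mem_range.1 hi; omega)).2.le
  calc _ ≤ (e + r) * j + e := Nat.add_le_add_right this _
    _ = _ := by ring

lemma TT_monic (x : F[X]) (hx : x.Monic) (r e j : ℕ) (hr : 1 ≤ r) (hxd : x.natDegree = r)
    (hj : j % 2 = 0) (hj1 : 0 < j) :
    (TT x e (j + 1)).Monic ∧ (TT x e (j + 1)).natDegree = e * (j + 1) + r * j := by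
  rw [TT_eq]
  set S := ∑ i ∈ range (j + 1), (1 + X ^ e * x + X ^ e) ^ i
      * (1 + X ^ e * x) ^ (j + 1 - 1 - i) with hS
  have hle : S.natDegree ≤ (e + r) * j := by
    refine natDegree_sum_le_of_forall_le _ _ fun i hi => ?_
    rw [Nat.add_sub_cancel]
    exact (term_facts x hx r e j i hr hxd (by have := Finset.mem_range.1 hi; omega)).2.le
  have hco : S.coeff ((e + r) * j) = 1 := by
    rw [hS, finsetSum_coeff]
    rw [Finset.sum_congr rfl (g := fun _ => (1 : F))]
    · simp only [Finset.sum_const, Finset.card_range, nsmul_eq_mul, mul_one]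
      rw [CharTwo.natCast_eq_mod, show (j + 1) % 2 = 1 by omega, Nat.cast_one]
    · intro i hi
      rw [Nat.add_sub_cancel]
      have := term_facts x hx r e j i hr hxd (by have := Finset.mem_range.1 hi; omega)
      rw [← this.2]; exact this.1
  have hSm : S.Monic := monic_of_natDegree_le_of_coeff_eq_one _ hle hco
  have hSd : S.natDegree = (e + r) * j :=
    natDegree_eq_of_le_of_coeff_ne_zero hle (by rw [hco]; exact one_ne_zero)
  have hm2 : (S * X ^ e).Monic := hSm.mul (monic_X_pow e)
  have hd2 : (S * X ^ e).natDegree = e * (j + 1) + r * j := by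
    rw [hSm.natDegree_mul (monic_X_pow e), hSd, natDegree_X_pow]; ring
  have hlt : (1 + (1 + (X : F[X]) ^ e) ^ (j + 1)).natDegree < (S * X ^ e).natDegree := by
    rw [hd2]
    have h3 := V_deg (F := F) e (j + 1)
    have : 0 < r * j := Nat.mul_pos hr hj1
    omega
  refine ⟨hm2.add_of_right (degree_lt_degree hlt), ?_⟩
  rw [natDegree_add_eq_right_of_natDegree_lt hlt, hd2]

end deg
end KW

namespace KW
open Polynomial Finset

lemma choose3_odd (d : ℕ) (hd : d % 4 = 3) : d.choose 3 % 2 = 1 := by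
  obtain ⟨n, rfl⟩ : ∃ n, d = 4 * n + 3 := ⟨d / 4, by omega⟩
  clear hd
  induction n with
  | zero => decide
  | succ n ih =>
    have key : ∀ m : ℕ, (m + 4).choose 3 = m.choose 3 + 4 * m.choose 2 + 6 * m + 4 := by
      intro m
      rw [show m + 4 = m + 1 + 1 + 1 + 1 by ring]
      simp only [Nat.choose_succ_succ' _ 2, Nat.choose_succ_succ' _ 1, Nat.choose_one_right]
      ring
    rw [show 4 * (n + 1) + 3 = (4 * n + 3) + 4 by ring, key]
    omega

set_option maxHeartbeats 1000000 in
lemma Psi_exists {F : Type} [Field F] [CharP F 2] (k Q t d e r : ℕ) (hk : 2 ≤ k) (hQ : Q = 2 ^ k)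
    (ht : t = Q * (Q - 1) + 1) (hd : d % 4 = 3) (het : t = d + e) (he : 2 ≤ e) (hr : Q = r + 2)
    (h : F[X]) (hh : h.natDegree = d) (x0 : F) :
    ∃ Ψ : F[X][X], Ψ.Monic ∧ Ψ.natDegree ≤ e * t + r * t ∧ (∀ l, (Ψ.coeff l).natDegree ≤ t) ∧
      Ψ.coeff 0 = C (x0 ^ Q + x0) + C (h.coeff d * (x0 ^ 2 + x0)) * X ^ e ∧
      Ψ.coeff 1 = 1 + C (h.coeff d) * X ^ e ∧
      ∀ y s : F, y ≠ 0 → s ≠ 0 → Ψ.evalEval y s = 0 →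
        (X ^ t + h).eval (1 / (y * s ^ r)) +
        (X ^ t + h).eval ((1 + s ^ e * (x0 + s + s ^ r)) / (y * s ^ r)) +
        (X ^ t + h).eval ((1 + s ^ e) / (y * s ^ r)) +
        (X ^ t + h).eval ((1 + s ^ e * (x0 + s + s ^ r) + s ^ e) / (y * s ^ r)) = 0 := by
  have h4 : 2 ^ 2 ≤ 2 ^ k := Nat.pow_le_pow_right (by norm_num) hk
  have hr2 : 2 ≤ r := by omega
  have hQe : 2 ∣ Q := hQ ▸ dvd_pow_self 2 (by omega)
  set x : F[X] := C x0 + X + X ^ r with hx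
  have hxm : x.Monic ∧ x.natDegree = r := by
    have hlt : (C x0 + X : F[X]).natDegree < (X ^ r : F[X]).natDegree := by
      rw [natDegree_X_pow]
      refine lt_of_le_of_lt (natDegree_add_le _ _) ?_
      simp; omega
    refine ⟨(monic_X_pow r).add_of_right (degree_lt_degree hlt), ?_⟩
    rw [hx, natDegree_add_eq_right_of_natDegree_lt hlt, natDegree_X_pow]
  obtain ⟨hxm, hxd⟩ := hxm
  obtain ⟨G, hG⟩ := T_big ((X : F[X]) ^ e) x k hk
  have hs := fun j => T_small ((X : F[X]) ^ e) x j
  choose g hg using hs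
  set θ : F[X] := x ^ 2 ^ k + x + X ^ e * G with hθ
  set τ : ℕ → F[X] := fun j => ((j.choose 3 : ℕ) : F[X]) * (x ^ 2 + x) + X ^ e * g j with hτ
  have hTθ : TT x e t = (X ^ e) ^ (Q + 1) * θ := by
    rw [TT, ht, hQ]; exact hG
  have hTτ : ∀ j, TT x e j = (X ^ e) ^ 3 * τ j := fun j => by rw [TT]; exact hg j
  have hxp : x = C x0 + X + X ^ 2 * X ^ (r - 2) := by
    rw [hx, ← pow_add, Nat.add_sub_cancel' hr2]
  have hXe : (X : F[X]) ^ e = X ^ 2 * X ^ (e - 2) := by rw [← pow_add, Nat.add_sub_cancel' he]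
  have hθ2 : ∃ G', θ = C (x0 ^ Q + x0) + X + X ^ 2 * G' := by
    have hXQ : (X : F[X]) ^ Q = X ^ 2 * X ^ r := by rw [← pow_add, hr, add_comm]
    refine ⟨X ^ r + X ^ r * (X ^ (r - 2)) ^ Q * X ^ Q + X ^ (r - 2) + X ^ (e - 2) * G, ?_⟩
    rw [hθ, ← hQ]
    have : x ^ Q = C x0 ^ Q + X ^ Q + X ^ Q * X ^ Q * (X ^ (r - 2)) ^ Q := by
      rw [hxp, hQ, add_pow_char_pow, add_pow_char_pow, mul_pow, ← pow_mul, ← pow_add, two_mul]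
    rw [this, hXe, hxp, map_add, C_pow, hXQ]
    ring
  have hτ2 : ∃ G', τ d = C (x0 ^ 2 + x0) + X + X ^ 2 * G' := by
    have hc : ((d.choose 3 : ℕ) : F[X]) = 1 := by
      rw [CharTwo.natCast_eq_mod, choose3_odd d hd, Nat.cast_one]
    refine ⟨1 + (X ^ (r - 2)) ^ 2 * X ^ 2 + X ^ (r - 2) + X ^ (e - 2) * g d, ?_⟩
    have : x ^ 2 = C x0 ^ 2 + X ^ 2 + (X ^ 2 * X ^ (r - 2)) ^ 2 := by
      rw [hxp, CharTwo.add_sq, CharTwo.add_sq]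
    simp only [hτ]
    rw [this, hc, hXe, hxp, map_add, C_pow]
    ring
  obtain ⟨G1, hG1⟩ := hθ2
  obtain ⟨G2, hG2⟩ := hτ2
  -- degrees
  obtain ⟨hTm, hTd⟩ := TT_monic x hxm r e (Q * (Q - 1)) (by omega) hxd
    (by obtain ⟨c, rfl⟩ := hQe; rw [mul_assoc]; simp) (Nat.mul_pos (by omega) (by omega))
  rw [← ht] at hTm hTd
  have hmp : ((X ^ e : F[X]) ^ (Q + 1)).Monic := (monic_X_pow e).pow _
  rw [hTθ] at hTm hTd
  have hθm : θ.Monic := hmp.of_mul_monic_left hTm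
  have hθd : e * (Q + 1) + θ.natDegree = e * t + r * (Q * (Q - 1)) := by
    rw [← hTd, hmp.natDegree_mul hθm, ← pow_mul, natDegree_X_pow]
  have hth : Q * (Q - 1) = d - 1 + e := by omega
  have hτd : ∀ j ∈ range (d + 1), (X ^ (r * (d - j)) * τ j).natDegree < θ.natDegree := by
    intro j hj
    have hj := Finset.mem_range.1 hj
    have hed : e * (Q + 1) = 3 * e + r * e := by rw [hr]; ring
    have hN : 3 * e + θ.natDegree = e * t + r * (d - 1) := by
      rw [hth, mul_add r, hed] at hθd; omega
    have hetd : e * t = e * d + e * e := by rw [het]; ring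
    have hee : 2 * 2 ≤ e * e := Nat.mul_le_mul he he
    have h2e : 2 * e ≤ e * e := Nat.mul_le_mul_right _ he
    have hd3 : e * 3 ≤ e * d := Nat.mul_le_mul_left _ (by omega)
    have hτ0 : τ j = 0 ∨ τ j ≠ 0 := em _
    rcases hτ0 with h0 | h0
    · rw [h0, mul_zero, natDegree_zero]; omega
    · have hm3 : ((X ^ e : F[X]) ^ 3).Monic := (monic_X_pow e).pow _
      rcases j with _ | j
      · exfalso; apply h0
        have := hTτ 0
        rw [TT_zero] at this
        exact (mul_eq_zero.1 this.symm).resolve_left hm3.ne_zero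
      have hdeg := TT_deg x hxm r e j (by omega) hxd
      rw [hTτ, hm3.natDegree_mul' h0, ← pow_mul, natDegree_X_pow] at hdeg
      rw [(monic_X_pow _).natDegree_mul' h0, natDegree_X_pow]
      have h5 : r * (d - (j + 1)) + r * j = r * (d - 1) := by rw [← mul_add]; congr 1; omega
      have h6 : e * (j + 1) ≤ e * d := Nat.mul_le_mul_left _ (by omega)
      omega
  have hcm : ∀ j l, (C (C (h.coeff j) * X ^ (t - j)) * (X ^ (r * (d - j)) * τ j).map C).coeff l =
      C (h.coeff j * (X ^ (r * (d - j)) * τ j).coeff l) * X ^ (t - j) := by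
    intro j l
    rw [coeff_C_mul, coeff_map, map_mul]; ring
  have hlow : ∀ j ∈ range d, ∀ l < 2, (X ^ (r * (d - j)) * τ j).coeff l = 0 := by
    intro j hj l hl
    have hj := Finset.mem_range.1 hj
    rw [coeff_X_pow_mul', if_neg]
    have : 2 * 1 ≤ r * (d - j) := Nat.mul_le_mul hr2 (by omega)
    omega
  have hcl : ∀ l < 2, (θ.map C + ∑ j ∈ range (d + 1), C (C (h.coeff j) * X ^ (t - j)) *
      (X ^ (r * (d - j)) * τ j).map C).coeff l =
      C (θ.coeff l) + C (h.coeff d * (τ d).coeff l) * X ^ e := by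
    intro l hl
    rw [coeff_add, coeff_map, finsetSum_coeff, Finset.sum_range_succ, Finset.sum_eq_zero, hcm,
      zero_add, Nat.sub_self, mul_zero, pow_zero, one_mul, het, Nat.add_sub_cancel_left]
    intro j hj
    rw [hcm, hlow j hj l hl, mul_zero, map_zero, zero_mul]
  have hmC : (θ.map C).Monic := hθm.map C
  have hdC : (θ.map C).natDegree = θ.natDegree := hθm.natDegree_map C
  have hθpos : 0 < θ.natDegree := lt_of_le_of_lt (Nat.zero_le _) (hτd 0 (by simp))
  have hsum : (∑ j ∈ range (d + 1), C (C (h.coeff j) * X ^ (t - j)) *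
      (X ^ (r * (d - j)) * τ j).map C).natDegree < (θ.map C).natDegree := by
    rw [hdC]
    refine lt_of_le_of_lt (natDegree_sum_le_of_forall_le (n := θ.natDegree - 1) _ _
      fun j hj => ?_) (by omega)
    refine (natDegree_C_mul_le _ _).trans (natDegree_map_le.trans ?_)
    have := hτd j hj
    omega
  obtain ⟨Ψ, hΨ⟩ : ∃ Ψ : F[X][X], Ψ = θ.map C + ∑ j ∈ range (d + 1),
      C (C (h.coeff j) * X ^ (t - j)) * (X ^ (r * (d - j)) * τ j).map C := ⟨_, rfl⟩
  have hΨm : Ψ.Monic := by rw [hΨ]; exact hmC.add_of_left (degree_lt_degree hsum)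
  rw [← hΨ] at hcl
  refine ⟨Ψ, hΨm, ?_, ?_, ?_, ?_, ?_⟩
  · rw [hΨ, natDegree_add_eq_left_of_natDegree_lt hsum, hdC]
    have : r * (Q * (Q - 1)) ≤ r * t := Nat.mul_le_mul_left _ (by omega)
    omega
  · intro l
    rw [hΨ, coeff_add, coeff_map, finsetSum_coeff]
    refine (natDegree_add_le _ _).trans (max_le (by simp) ?_)
    refine natDegree_sum_le_of_forall_le _ _ fun j hj => ?_
    rw [hcm]
    refine (natDegree_C_mul_X_pow_le _ _).trans (by omega)
  · rw [hcl 0 (by norm_num), hG1, hG2]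
    have hz : ∀ (c : F) (G' : F[X]), (C c + X + X ^ 2 * G').coeff 0 = c := by
      intro c G'
      simp [-map_pow, coeff_X_pow_mul']
    rw [hz, hz]
  · rw [hcl 1 (by norm_num), hG1, hG2]
    have hz : ∀ (c : F) (G' : F[X]), (C c + X + X ^ 2 * G').coeff 1 = 1 := by
      intro c G'
      simp [coeff_X_pow_mul', coeff_C]
    rw [hz, hz, map_one, mul_one]
  · intro y s hy hs0 hz
    set w := y * s ^ r with hw
    have hw0 : w ≠ 0 := mul_ne_zero hy (pow_ne_zero _ hs0)
    have hev : ∀ p : F[X], (p.map C).evalEval y s = p.eval s := by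
      intro p
      simp [evalEval, eval_map, eval₂_at_apply]
    have hz2 : θ.eval s + ∑ j ∈ range (d + 1), h.coeff j * y ^ (t - j) *
        (s ^ (r * (d - j)) * (τ j).eval s) = 0 := by
      rw [← hz, hΨ, ← coe_evalEvalRingHom, map_add, map_sum, coe_evalEvalRingHom, hev]
      congr 1
      refine Finset.sum_congr rfl fun j _ => ?_
      rw [← coe_evalEvalRingHom, map_mul, coe_evalEvalRingHom, hev]
      have : (C (C (h.coeff j) * X ^ (t - j)) : F[X][X]).evalEval y s = h.coeff j * y ^ (t - j) := by
        rw [evalEval_C]; simp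
      rw [this]; simp
    set U := s ^ e * (x0 + s + s ^ r) with hU
    have hxs : x.eval s = x0 + s + s ^ r := by simp [hx]
    have hTe : ∀ j, (TT x e j).eval s = 1 + (1 + U) ^ j + (1 + s ^ e) ^ j + (1 + U + s ^ e) ^ j := by
      intro j
      simp [TT, hxs, hU]
    have hmain : w ^ t * ((X ^ t + h).eval (1 / w) + (X ^ t + h).eval ((1 + U) / w) +
        (X ^ t + h).eval ((1 + s ^ e) / w) + (X ^ t + h).eval ((1 + U + s ^ e) / w)) =
        (TT x e t).eval s + ∑ j ∈ range (d + 1), h.coeff j * w ^ (t - j) * (TT x e j).eval s := by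
      simp only [eval_add, eval_pow, eval_X, hTe]
      simp only [eval_eq_sum_range, hh]
      have : ∀ A B C' D a b c e : F, w ^ t * ((A + a) + (B + b) + (C' + c) + (D + e)) =
        w ^ t * (A + B + C' + D) + w ^ t * (a + b + c + e) := by intros; ring
      rw [this, ← Finset.sum_add_distrib, ← Finset.sum_add_distrib, ← Finset.sum_add_distrib,
        Finset.mul_sum]
      congr 1
      · simp only [div_pow, one_pow]
        field_simp
      · refine Finset.sum_congr rfl fun j hj => ?_
        have hj := Finset.mem_range.1 hj
        have : w ^ t = w ^ (t - j) * w ^ j := by rw [← pow_add]; congr 1; omega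
        rw [this]
        simp only [div_pow, one_pow]
        field_simp
    have hfin : (TT x e t).eval s + ∑ j ∈ range (d + 1), h.coeff j * w ^ (t - j) *
        (TT x e j).eval s = s ^ (e * (Q + 1)) * (θ.eval s + ∑ j ∈ range (d + 1),
          h.coeff j * y ^ (t - j) * (s ^ (r * (d - j)) * (τ j).eval s)) := by
      rw [mul_add, Finset.mul_sum, hTθ]
      congr 1
      · simp [pow_mul]
      · refine Finset.sum_congr rfl fun j hj => ?_
        have hj := Finset.mem_range.1 hj
        rw [hTτ, hw, mul_pow]
        have h7 : s ^ (e * (Q + 1)) * s ^ (r * (d - j)) = (s ^ r) ^ (t - j) * (s ^ e) ^ 3 := by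
          rw [← pow_mul, ← pow_mul, ← pow_add, ← pow_add]
          congr 1
          have : r * (t - j) = r * (d - j) + r * e := by rw [← mul_add]; congr 1; omega
          rw [this, hr]; ring
        simp only [eval_mul, eval_pow, eval_X]
        linear_combination (-(h.coeff j * y ^ (t - j) * (τ j).eval s)) * h7
    rw [hfin, hz2, mul_zero] at hmain
    exact (mul_eq_zero.1 hmain).resolve_left (pow_ne_zero _ hw0)
end KW

namespace KW
open Polynomial Finset

lemma xpoly_facts {F : Type} [Field F] (c : F) (r : ℕ) (hr : 2 ≤ r) :
    (C c + X + X ^ r : F[X]) ≠ 0 ∧ (C c + X + X ^ r : F[X]).natDegree = r := by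
  have hlt : (C c + X : F[X]).natDegree < (X ^ r : F[X]).natDegree := by
    rw [natDegree_X_pow]
    refine lt_of_le_of_lt (natDegree_add_le _ _) ?_
    simp; omega
  refine ⟨((monic_X_pow r).add_of_right (degree_lt_degree hlt)).ne_zero, ?_⟩
  rw [natDegree_add_eq_right_of_natDegree_lt hlt, natDegree_X_pow]

/-- few `y` lie under a finite set of bad values of `s` -/
lemma good_point {F : Type} [Field F] [Fintype F] (R : F[X][X]) (hm : R.Monic)
    (hirr : Irreducible (R.map (mapRingHom (algebraMap F (AlgebraicClosure F)))))
    (y0 : F) (h0 : R.evalEval y0 0 = 0) (hX : ¬ X ∣ R) (c : ℕ)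
    (hc : ∀ l, (R.coeff l).natDegree ≤ c) (S : Finset F)
    (hB : 1 + S.card * c < {y : F | ∃ s, R.evalEval y s = 0}.ncard) :
    ∃ y s, y ≠ 0 ∧ s ∉ S ∧ R.evalEval y s = 0 := by
  classical
  have hne : ∀ s : F, eval (C s) R ≠ 0 := by
    intro s hs
    obtain ⟨R', hR'⟩ := dvd_iff_isRoot.2 hs
    have hm' : R'.Monic := (monic_X_sub_C (C s)).of_mul_monic_left (hR' ▸ hm)
    have h1 := hR' ▸ hirr
    rw [Polynomial.map_mul] at h1
    have hd : R'.natDegree = 0 := by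
      rcases h1.isUnit_or_isUnit rfl with hu | hu
      · exfalso
        have h2 := natDegree_eq_zero_of_isUnit hu
        rw [(monic_X_sub_C (C s)).natDegree_map, natDegree_X_sub_C] at h2
        exact one_ne_zero h2
      · have h2 := natDegree_eq_zero_of_isUnit hu
        rwa [hm'.natDegree_map] at h2
    rw [hm'.natDegree_eq_zero.1 hd, mul_one] at hR'
    have hs0 : s = 0 := by
      rw [hR'] at h0
      simpa [evalEval] using h0
    apply hX
    rw [hR', hs0]; simp
  have hdeg : ∀ s : F, (eval (C s) R).natDegree ≤ c := by
    intro s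
    rw [eval_eq_sum_range]
    refine natDegree_sum_le_of_forall_le _ _ fun i _ => ?_
    rw [← C_pow]
    exact (natDegree_mul_C_le _ _).trans (hc i)
  set B : Finset F := insert 0 (S.biUnion fun s => (eval (C s) R).roots.toFinset) with hBd
  have hcard : B.card ≤ 1 + S.card * c := by
    refine (Finset.card_insert_le _ _).trans ?_
    rw [add_comm]
    refine Nat.add_le_add_left (Finset.card_biUnion_le_card_mul _ _ _ fun s _ => ?_) _
    exact (Multiset.toFinset_card_le _).trans ((card_roots' _).trans (hdeg s))
  have hex : ∃ y ∈ {y : F | ∃ s, R.evalEval y s = 0}, y ∉ (B : Set F) := by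
    by_contra hcon
    push Not at hcon
    have h3 := Set.ncard_le_ncard (show {y : F | ∃ s, R.evalEval y s = 0} ⊆ (B : Set F) from hcon)
      (Set.toFinite _)
    rw [Set.ncard_coe_finset] at h3
    omega
  obtain ⟨y, ⟨s, hs⟩, hy⟩ := hex
  refine ⟨y, s, ?_, ?_, hs⟩
  · rintro rfl; exact hy (by simp [hBd])
  · intro hsS
    apply hy
    rw [hBd, Finset.mem_coe]
    refine Finset.mem_insert_of_mem (Finset.mem_biUnion.2 ⟨s, hsS, ?_⟩)
    rw [Multiset.mem_toFinset, mem_roots (hne s)]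
    exact hs

lemma three_sol {F : Type} [Field F] [Fintype F] [CharP F 2] (f : F → F) (w U V : F) (hw : w ≠ 0)
    (hU : U ≠ 0) (hV : V ≠ 0) (hUV : U ≠ V)
    (h : f (1 / w) + f ((1 + U) / w) + f ((1 + V) / w) + f ((1 + U + V) / w) = 0) :
    ∃ a b : F, a ≠ 0 ∧ 2 < {x : F | f (x + a) + f x = b}.ncard := by
  refine ⟨U / w, f (1 / w) + f ((1 + U) / w), div_ne_zero hU hw, ?_⟩
  have e1 : 1 / w + U / w = (1 + U) / w := by ring
  have e2 : (1 + U) / w + U / w = 1 / w := by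
    rw [← add_div, add_assoc, CharTwo.add_self_eq_zero, add_zero]
  have e3 : (1 + V) / w + U / w = (1 + U + V) / w := by ring
  have hsub : ({1 / w, (1 + U) / w, (1 + V) / w} : Set F) ⊆
      {x : F | f (x + U / w) + f x = f (1 / w) + f ((1 + U) / w)} := by
    rintro z (rfl | rfl | rfl)
    · simp only [Set.mem_ofPred_eq]; rw [e1, add_comm]
    · simp only [Set.mem_ofPred_eq]; rw [e2]
    · simp only [Set.mem_ofPred_eq]; rw [e3]
      have h2 : (2 : F) = 0 := CharTwo.two_eq_zero
      linear_combination h - (f (1 / w) + f ((1 + U) / w)) * h2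
  have h3 : ({1 / w, (1 + U) / w, (1 + V) / w} : Set F).ncard = 3 := by
    rw [Set.ncard_eq_three]
    refine ⟨_, _, _, ?_, ?_, ?_, rfl⟩
    · intro h; rw [div_left_inj' hw] at h; exact hU (by linear_combination -h)
    · intro h; rw [div_left_inj' hw] at h; exact hV (by linear_combination -h)
    · intro h; rw [div_left_inj' hw] at h; exact hUV (by linear_combination h)
  have := Set.ncard_le_ncard hsub (Set.toFinite _)
  omega

lemma thmB (k t d : ℕ) (hk : 2 ≤ k) (ht : t = 2 ^ k * (2 ^ k - 1) + 1) (hd : d % 4 = 3)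
    (hdt : d < t) :
    ∃ q0 : ℕ, ∀ (F : Type) [Field F] [Fintype F] [CharP F 2], q0 ≤ Fintype.card F →
      ∀ h : F[X], h.natDegree = d →
      ∃ a b : F, a ≠ 0 ∧ 2 < {x : F | (X ^ t + h).eval (x + a) + (X ^ t + h).eval x = b}.ncard := by
  classical
  obtain ⟨Q, hQ⟩ : ∃ Q, Q = 2 ^ k := ⟨_, rfl⟩
  have h4 : 2 ^ 2 ≤ 2 ^ k := Nat.pow_le_pow_right (by norm_num) hk
  obtain ⟨r, hr⟩ : ∃ r, Q = r + 2 := ⟨Q - 2, by omega⟩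
  obtain ⟨e, het⟩ : ∃ e, t = d + e := ⟨t - d, by omega⟩
  have he4 : e % 4 = 2 := by
    have : 4 ∣ 2 ^ k * (2 ^ k - 1) := Dvd.dvd.mul_right (pow_dvd_pow 2 hk) _
    omega
  obtain ⟨m, hm⟩ : ∃ m, e = 2 * m := ⟨e / 2, by omega⟩
  obtain ⟨q1, hq1⟩ := point_C0 k m hk (by omega)
  obtain ⟨q2, hq2⟩ := stepanov (e * t + r * t) t (1 + (1 + 2 * r) * t)
  refine ⟨max q1 q2, fun F _ _ _ hq h hh => ?_⟩
  have ha : h.coeff d ≠ 0 := by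
    rw [← hh]; apply leadingCoeff_ne_zero.2; rintro rfl
    rw [natDegree_zero] at hh; omega
  obtain ⟨x0, y0, hxy, hne1, hx0⟩ := hq1 F ((le_max_left _ _).trans hq) _ ha
  rw [← hm] at hxy hne1
  obtain ⟨Ψ, hΨm, hΨd, hΨc, hΨ0, hΨ1, hΨz⟩ := Psi_exists k Q t d e r hk hQ (by rw [hQ]; exact ht) hd
    het (by omega) hr h hh x0
  have h2 : (2 : F) = 0 := CharTwo.two_eq_zero
  have hev : Ψ.evalEval y0 0 = 0 := by
    rw [evalEval, C_0, ← coeff_zero_eq_eval_zero, hΨ0, hQ]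
    simp only [eval_add, eval_mul, eval_C, eval_pow, eval_X]
    linear_combination hxy + (x0 ^ 2 ^ k + x0) * h2
  have hev1 : (derivative Ψ).evalEval y0 0 ≠ 0 := by
    rw [evalEval, C_0, ← coeff_zero_eq_eval_zero, coeff_derivative, zero_add, hΨ1]
    simp only [eval_add, eval_mul, eval_C, eval_pow, eval_X, eval_one, Nat.cast_zero, zero_add,
      mul_one]
    intro h5
    apply hne1
    linear_combination h5 - h2
  obtain ⟨R, hRm, hRd, hRi, hR0, hRder, hRc⟩ := smooth_factor Ψ hΨm y0 0 hev hev1 t hΨc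
  have hRdeg : R.natDegree ≤ e * t + r * t :=
    (natDegree_le_of_dvd hRd hΨm.ne_zero).trans hΨd
  have hcnt := hq2 F ((le_max_right _ _).trans hq) R hRm hRdeg hRc hRi hRder
  have hX : ¬ X ∣ R := by
    intro h5
    have h6 := X_dvd_iff.1 (h5.trans hRd)
    rw [hΨ0] at h6
    have h7 := congrArg (fun p => coeff p e) h6
    simp only [coeff_add, coeff_C_mul, coeff_X_pow_self, mul_one, coeff_zero, coeff_C,
      if_neg (show e ≠ 0 by omega), zero_add] at h7
    exact mul_ne_zero ha hx0 h7
  obtain ⟨S, hS⟩ : ∃ S : Finset F, S = insert 0 ((C x0 + X + X ^ r : F[X]).roots.toFinset ∪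
    (C (x0 + 1) + X + X ^ r : F[X]).roots.toFinset) := ⟨_, rfl⟩
  have hroots : ∀ c : F, (C c + X + X ^ r : F[X]).roots.toFinset.card ≤ r := fun c =>
    (Multiset.toFinset_card_le _).trans ((card_roots' _).trans
      (xpoly_facts c r (by omega)).2.le)
  have hScard : S.card ≤ 1 + 2 * r := by
    rw [hS]
    refine (Finset.card_insert_le _ _).trans ?_
    have h5 := Finset.card_union_le (C x0 + X + X ^ r : F[X]).roots.toFinset
      (C (x0 + 1) + X + X ^ r : F[X]).roots.toFinset
    have h6 := hroots x0
    have h7 := hroots (x0 + 1)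
    omega
  obtain ⟨y, s, hy, hsS, hys⟩ := good_point R hRm hRi y0 hR0 hX t hRc S
    (lt_of_le_of_lt (Nat.add_le_add_left (Nat.mul_le_mul_right _ hScard) _) hcnt)
  have hs0 : s ≠ 0 := by rintro rfl; exact hsS (by simp [hS])
  have hx1 : x0 + s + s ^ r ≠ 0 := by
    intro h5
    apply hsS
    rw [hS]
    refine Finset.mem_insert_of_mem (Finset.mem_union_left _ ?_)
    rw [Multiset.mem_toFinset, mem_roots (xpoly_facts x0 r (by omega)).1]
    simpa [IsRoot] using h5
  have hx2 : x0 + s + s ^ r ≠ 1 := by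
    intro h5
    apply hsS
    rw [hS]
    refine Finset.mem_insert_of_mem (Finset.mem_union_right _ ?_)
    rw [Multiset.mem_toFinset, mem_roots (xpoly_facts (x0 + 1) r (by omega)).1, IsRoot]
    simp only [eval_add, eval_C, eval_pow, eval_X]
    linear_combination h5 + h2
  have hΨys : Ψ.evalEval y s = 0 := by
    obtain ⟨T, hT⟩ := hRd
    rw [hT, evalEval_mul, hys, zero_mul]
  have hV : s ^ e ≠ 0 := pow_ne_zero _ hs0
  have hw : y * s ^ r ≠ 0 := mul_ne_zero hy (pow_ne_zero _ hs0)
  have hUV : s ^ e * (x0 + s + s ^ r) ≠ s ^ e := by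
    intro h5
    exact hx2 (mul_left_cancel₀ hV (by rw [h5, mul_one]))
  have hzz := hΨz y s hy hs0 hΨys
  have hU : s ^ e * (x0 + s + s ^ r) ≠ 0 := mul_ne_zero hV hx1
  generalize s ^ e * (x0 + s + s ^ r) = U at hU hUV hzz
  generalize s ^ e = V at hV hUV hzz
  generalize y * s ^ r = w at hw hzz
  generalize (X ^ t + h) = p at hzz ⊢
  exact three_sol (fun z => eval z p) w U V hw hU hV hUV hzz
end KW

open MvPolynomial

/-- Let `L = F_{2^n}`, `t = 2^(2k) - 2^k + 1` (k ≥ 2) the Kasami–Welch number, and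
`f(x) = x^t + h(x) ∈ L[x]` with `3 ≤ deg h < t` and `deg h ≡ 3 (mod 4)`.  Then `f` is not
exceptional APN: there are only finitely many `m ≥ 1` such that `f` is APN on `F_{2^(nm)}`
(via an inclusion `L → F_{2^(nm)}`). -/
theorem kasami_plus_3mod4_not_exceptional_APN (n : ℕ) (hn : 1 ≤ n) (k : ℕ) (hk : 2 ≤ k)
    (t : ℕ) (ht : t = 2 ^ (2 * k) - 2 ^ k + 1)
    (h : Polynomial (GaloisField 2 n))
    (hd3 : 3 ≤ h.natDegree) (hdt : h.natDegree < t) (hdmod : h.natDegree % 4 = 3)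
    (f : Polynomial (GaloisField 2 n)) (hf : f = Polynomial.X ^ t + h) :
    {m : ℕ | 1 ≤ m ∧ ∀ ι : GaloisField 2 n →+* GaloisField 2 (n * m),
      IsAPN (fun x => Polynomial.eval x (f.map ι))}.Finite := by
  classical
  have h22 : (2 ^ k) * (2 ^ k) = 2 ^ (2 * k) := by rw [← pow_add, two_mul]
  have ht' : t = 2 ^ k * (2 ^ k - 1) + 1 := by
    rw [ht, Nat.mul_sub, h22, mul_one]
  obtain ⟨q0, hq0⟩ := KW.thmB k t h.natDegree hk ht' hdmod hdt
  refine (Set.finite_lt_nat (q0 + 1)).subset ?_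
  rintro m ⟨hm, hapn⟩
  by_contra hlt
  have hqm : q0 ≤ m := by
    by_contra hcon
    exact hlt (show m < q0 + 1 by omega)
  have hnm : n * m ≠ 0 := Nat.mul_ne_zero (by omega) (by omega)
  obtain ⟨φ⟩ := FiniteField.nonempty_algHom_of_finrank_dvd (F := ZMod 2)
    (K := GaloisField 2 n) (L := GaloisField 2 (n * m)) (by
      rw [GaloisField.finrank 2 (show n ≠ 0 by omega), GaloisField.finrank 2 hnm]
      exact Dvd.intro _ rfl)
  have : Fintype (GaloisField 2 (n * m)) := Fintype.ofFinite _
  have hcard : q0 ≤ Fintype.card (GaloisField 2 (n * m)) := by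
    rw [← Nat.card_eq_fintype_card, GaloisField.card 2 _ hnm]
    have h1 : m ≤ n * m := Nat.le_mul_of_pos_left _ (by omega)
    have h2 : n * m < 2 ^ (n * m) := Nat.lt_two_pow_self
    omega
  have : CharP (GaloisField 2 (n * m)) 2 := inferInstance
  obtain ⟨a, b, ha, hb⟩ := hq0 (GaloisField 2 (n * m)) hcard
    (h.map (φ : GaloisField 2 n →+* GaloisField 2 (n * m))) (Polynomial.natDegree_map _)
  have hA := hapn (φ : GaloisField 2 n →+* GaloisField 2 (n * m)) a b ha
  rw [hf, Polynomial.map_add, Polynomial.map_pow, Polynomial.map_X] at hA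
  exact absurd hA (not_le.2 hb)
end
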